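/- arXiv:1705.08776 — 8 statements merged into one kernel-verified Lean document; each statement's English description precedes it below -/
import Mathlib

section
/- Suppose g : ℝ → ℝ is locally Lipschitz and satisfies conditions (g0) and (g1), and p : ℝ × ℝ × ℝ → ℝ is continuous, bounded, and 2π-periodic in its first variable. Then the impulsive system (S) has at least one 2π-periodic solution; that is, there exists a solution (x, y) of (S) on all of ℝ such that x(t + 2π) = x(t) and y(t + 2π) = y(t) for all t ∈ ℝ. -/
open Real Set Filter MeasureTheory

/-- The primitive `G(x) = ∫₀ˣ g(s) ds`. -/
noncomputable def primG (g : ℝ → ℝ) : ℝ → ℝ := fun x => ∫ s in (0:ℝ)..x, g s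

/-- Condition (g0): `g(x)/x → 0` as `|x| → +∞`. -/
def CondG0 (g : ℝ → ℝ) : Prop :=
  Tendsto (fun x => g x / x) (cocompact ℝ) (nhds 0)

/-- Condition (g1): `g(x)·sign(x) → +∞` as `|x| → +∞`, and for every sufficiently large
`x⁺ > 0` there is `x⁻ < 0` with `G(x⁻) = G(x⁺)` and
`∫_{x⁻}^{x⁺} ds/√(G(x⁺) − G(s)) → +∞` as `x⁺ → +∞`. -/
def CondG1 (g : ℝ → ℝ) : Prop :=
  Tendsto (fun x => g x * Real.sign x) (cocompact ℝ) atTop ∧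
  ∃ xm : ℝ → ℝ,
    (∀ᶠ xp in atTop, xm xp < 0 ∧ primG g (xm xp) = primG g xp) ∧
    Tendsto (fun xp => ∫ s in (xm xp)..xp, 1 / Real.sqrt (primG g xp - primG g s))
      atTop atTop

/-- A solution of the impulsive system (S) on the interval `I`:
`x' = y`, `y' = −g(x) + p(t, x, y)` away from the impulse times `tj j`, the functions are
left-continuous on `I`, continuous at non-impulse points of `I`, and at every impulse time
interior to `I` the right limits exist and equal `(1+a)` times the (left) values. -/
def IsSolution (tj : ℤ → ℝ) (a : ℝ) (g : ℝ → ℝ) (p : ℝ × ℝ × ℝ → ℝ)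
    (I : Set ℝ) (x y : ℝ → ℝ) : Prop :=
  (∀ t ∈ I, ContinuousWithinAt x (I ∩ Iic t) t ∧ ContinuousWithinAt y (I ∩ Iic t) t) ∧
  (∀ t ∈ I, (∀ j : ℤ, t ≠ tj j) →
    ContinuousWithinAt x I t ∧ ContinuousWithinAt y I t ∧
    HasDerivWithinAt x (y t) I t ∧
    HasDerivWithinAt y (-g (x t) + p (t, x t, y t)) I t) ∧
  (∀ j : ℤ, tj j ∈ interior I →
    Tendsto x (nhdsWithin (tj j) (Ioi (tj j))) (nhds ((1 + a) * x (tj j))) ∧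
    Tendsto y (nhdsWithin (tj j) (Ioi (tj j))) (nhds ((1 + a) * y (tj j))))

/-- A continuous angle lift `θ` of the pair `(x, y)` on `I`. -/
def IsAngleLift (x y : ℝ → ℝ) (I : Set ℝ) (θ : ℝ → ℝ) : Prop :=
  ContinuousOn θ I ∧ ∀ t ∈ I,
    x t = Real.sqrt ((x t) ^ 2 + (y t) ^ 2) * Real.cos (θ t) ∧
    y t = Real.sqrt ((x t) ^ 2 + (y t) ^ 2) * Real.sin (θ t)

theorem hs_brouwer (F : ℂ → ℂ) (hF : Continuous F) (C : ℝ)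
    (hb : ∀ z, ‖F z‖ ≤ ‖z‖ / 2 + C) : ∃ z, F z = z := by
  by_contra hne
  push Not at hne
  have hC : 0 ≤ C := by have := (norm_nonneg _).trans (hb 0); simpa using this
  obtain ⟨h, hc, he⟩ : ∃ h : ℂ → ℂ, Continuous h ∧ ∀ z, Complex.exp (h z) = z - F z := by
    obtain ⟨f, ⟨-, hf⟩, -⟩ := Complex.isCoveringMapOn_exp.existsUnique_continuousMap_lifts
      (A := ℂ) ⟨fun z => z - F z, by fun_prop⟩ (a₀ := 0) (e₀ := Complex.log (0 - F 0))
      (Complex.exp_log (sub_ne_zero.2 (hne 0).symm))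
      (fun z => by simpa using sub_ne_zero.2 (hne z).symm)
    exact ⟨f, map_continuous f, fun z => by simpa using congrFun hf z⟩
  set R : ℝ := 2 * C + 1 with hR
  have hRpos : 0 < R := by positivity
  let z : ℝ → ℂ := fun t => Complex.exp (Real.log R + t * Complex.I)
  have hznorm : ∀ t, ‖z t‖ = R := by
    intro t
    simp [z, Complex.norm_exp, Real.exp_log hRpos]
  have hzne : ∀ t, z t ≠ 0 := fun t => Complex.exp_ne_zero _
  have hzc : Continuous z := by fun_prop
  have hslit : ∀ t, 1 - F (z t) / z t ∈ Complex.slitPlane := by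
    intro t
    rw [sub_eq_add_neg]
    apply Complex.mem_slitPlane_of_norm_lt_one
    rw [norm_neg, norm_div, div_lt_one (by rw [hznorm]; exact hRpos)]
    have := hb (z t)
    rw [hznorm] at this ⊢
    linarith
  let φ : ℝ → ℂ := fun t => h (z t) - Complex.log (1 - F (z t) / z t) - (Real.log R + t * Complex.I)
  have hφc : Continuous φ := by
    have : Continuous fun t => Complex.log (1 - F (z t) / z t) := by
      refine Continuous.clog ?_ hslit
      exact continuous_const.sub ((hF.comp hzc).div hzc hzne)
    have h2 := hc.comp hzc
    have h3 : Continuous fun t : ℝ => ((Real.log R : ℂ) + t * Complex.I) := by fun_prop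
    exact (h2.sub this).sub h3
  have hφe : ∀ t, ∃ n : ℤ, φ t = n * (2 * π * Complex.I) := by
    intro t
    rw [← Complex.exp_eq_one_iff]
    simp only [φ]
    rw [Complex.exp_sub, Complex.exp_sub, he, Complex.exp_log (Complex.slitPlane_ne_zero (hslit t))]
    change (z t - F (z t)) / _ / z t = 1
    have h1 := Complex.slitPlane_ne_zero (hslit t)
    have h2 := hzne t
    have h3 : z t - F (z t) = z t * (1 - F (z t) / z t) := by field_simp
    rw [h3, mul_div_assoc, div_self h1, mul_one, div_self h2]
  let ψ : ℝ → ℝ := fun t => (φ t).im / (2 * π)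
  have hψc : Continuous ψ := by fun_prop
  have hψ : ∀ t, ∃ n : ℤ, ψ t = n := by
    intro t
    obtain ⟨n, hn⟩ := hφe t
    refine ⟨n, ?_⟩
    simp only [ψ, hn]
    have : ((n : ℂ) * (2 * π * Complex.I)).im = n * (2 * π) := by simp
    rw [this]
    field_simp
  have hz2 : z (2 * π) = z 0 := by
    simp only [z]
    push_cast
    rw [Complex.exp_add, Complex.exp_add, Complex.exp_two_pi_mul_I]
    simp
  have hend : ψ (2 * π) = ψ 0 - 1 := by
    simp only [ψ, φ, hz2]
    have : (2 * π) ≠ 0 := by positivity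
    field_simp
    simp
  obtain ⟨t, ht⟩ := mem_range_of_exists_le_of_exists_ge hψc (c := ψ 0 - 1 / 2)
    ⟨2 * π, by rw [hend]; linarith⟩ ⟨0, by linarith⟩
  obtain ⟨n, hn⟩ := hψ t
  obtain ⟨m, hm⟩ := hψ 0
  rw [hn, hm] at ht
  have : (2 * n : ℝ) = 2 * m - 1 := by linarith
  have : 2 * n = 2 * m - 1 := by exact_mod_cast this
  omega

noncomputable def hsEuler (M : ℝ → ℂ → ℂ) (h : ℝ) (z : ℂ) : ℕ → ℂ
  | 0 => z
  | (i+1) => hsEuler M h z i + ∫ s in (i * h)..((i + 1) * h), M s (hsEuler M h z i)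

theorem hs_intervalIntegrable (f : ℝ → ℂ) (hf : Measurable f) (K a b : ℝ)
    (hb : ∀ s ∈ Set.uIoc a b, ‖f s‖ ≤ K) : IntervalIntegrable f volume a b := by
  rw [intervalIntegrable_iff]
  refine Integrable.mono' (g := fun _ => K) ?_ hf.aestronglyMeasurable ?_
  · exact (intervalIntegrable_iff.1 (intervalIntegrable_const (c := K) (μ := volume) (a := a) (b := b)))
  · exact (ae_restrict_iff' measurableSet_uIoc).2 (Eventually.of_forall hb)

theorem hsEuler_continuous (M : ℝ → ℂ → ℂ) (T : ℝ) (hM : Measurable (Function.uncurry M))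
    (hMc : ∀ s, Continuous (M s))
    (e C : ℝ) (he : 0 ≤ e) (hg : ∀ s ∈ Icc 0 T, ∀ z, ‖M s z‖ ≤ e * ‖z‖ + C)
    (h : ℝ) (hh : 0 ≤ h) (i : ℕ) (hi : i * h ≤ T) : Continuous (fun z => hsEuler M h z i) := by
  induction i with
  | zero => exact continuous_id
  | succ i ih =>
    push_cast at hi
    have ih := ih (by nlinarith)
    simp only [hsEuler]
    refine ih.add ?_
    have : Continuous fun w : ℂ => ∫ s in (i * h)..((i + 1) * h), M s w := by
      rw [continuous_iff_continuousAt]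
      intro w
      refine intervalIntegral.continuousAt_of_dominated_interval
        (bound := fun _ => e * (‖w‖ + 1) + C) ?_ ?_ ?_ ?_
      · exact Eventually.of_forall fun v => 
          (hM.comp (measurable_id.prodMk measurable_const)).aestronglyMeasurable
      · filter_upwards [Metric.ball_mem_nhds w one_pos] with v hv
        refine Eventually.of_forall fun s hs => ?_
        rw [uIoc_of_le (by nlinarith)] at hs
        have hs1 : s ∈ Icc 0 T := ⟨by have := hs.1; have : 0 ≤ i * h := by positivity
                                      linarith, by linarith [hs.2]⟩
        refine (hg s hs1 v).trans ?_
        have : ‖v‖ ≤ ‖w‖ + 1 := by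
          have h1 : ‖v - w‖ < 1 := by simpa [dist_eq_norm] using hv
          have h2 := norm_add_le (v - w) w
          simp at h2
          linarith
        gcongr
      · exact intervalIntegrable_const
      · exact Eventually.of_forall fun s _ => (hMc s).continuousAt
    exact this.comp ih

theorem hs_main (M : ℝ → ℂ → ℂ) (T : ℝ) (hT : 0 < T) (hM : Measurable (Function.uncurry M))
    (hMc : ∀ s, Continuous (M s))
    (hg : ∀ e > 0, ∃ C, 0 ≤ C ∧ ∀ s ∈ Icc 0 T, ∀ z, ‖M s z‖ ≤ e * ‖z‖ + C)
    (Λ : ℂ →L[ℝ] ℂ) :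
    ∃ W : ℝ → ℂ, Continuous W ∧ (∀ t ∈ Icc 0 T, W t = W 0 + ∫ s in (0:ℝ)..t, M s (W s)) ∧
      W 0 = Λ (∫ s in (0:ℝ)..T, M s (W s)) := by
  set e : ℝ := 1 / (4 * T * (‖Λ‖ + 1)) with hedef
  have hepos : 0 < e := by positivity
  have heT : e * T ≤ 1 / 2 := by
    rw [hedef, div_mul_eq_mul_div, div_le_iff₀ (by positivity)]
    nlinarith [norm_nonneg Λ]
  have heL : ‖Λ‖ * T * e ≤ 1 / 4 := by
    rw [hedef, mul_one_div, div_le_iff₀ (by positivity)]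
    nlinarith [norm_nonneg Λ]
  obtain ⟨C, hC, hgr⟩ := hg e hepos
  -- bound along Euler
  have hEb : ∀ n : ℕ, 0 < n → ∀ z : ℂ, ∀ i : ℕ, i ≤ n →
      ‖hsEuler M (T / n) z i - z‖ ≤ i * (T / n) * (e * (2 * (‖z‖ + C * T)) + C) ∧
      ‖hsEuler M (T / n) z i‖ ≤ 2 * (‖z‖ + C * T) := by
    intro n hn z i
    have hn' : (0:ℝ) < n := by exact_mod_cast hn
    have hz := norm_nonneg z
    have key : ∀ i : ℕ, i ≤ n → 
        ‖hsEuler M (T / n) z i - z‖ ≤ i * (T / n) * (e * (2 * (‖z‖ + C * T)) + C) → 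
        ‖hsEuler M (T / n) z i‖ ≤ 2 * (‖z‖ + C * T) := by
      intro i hi h1
      have h2 : ‖hsEuler M (T / n) z i‖ ≤ ‖hsEuler M (T / n) z i - z‖ + ‖z‖ := by
        simpa using norm_add_le (hsEuler M (T / n) z i - z) z
      have h3 : (i:ℝ) * (T / n) ≤ T := by
        have : (i:ℝ) ≤ n := by exact_mod_cast hi
        calc (i:ℝ) * (T / n) ≤ n * (T / n) := by gcongr
          _ = T := by field_simp
      have h4 : i * (T / n) * (e * (2 * (‖z‖ + C * T)) + C) ≤
         T * (e * (2 * (‖z‖ + C * T)) + C) := by gcongr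
      have h5 : 0 ≤ ‖z‖ + C * T := by positivity
      nlinarith
    induction i with
    | zero => intro _; exact ⟨by simp [hsEuler], key 0 (by omega) (by simp [hsEuler])⟩
    | succ i ih =>
      intro hi
      obtain ⟨h1, h2⟩ := ih (by omega)
      suffices h : ‖hsEuler M (T / n) z (i+1) - z‖ ≤ ((i+1:ℕ):ℝ) * (T / n) * (e * (2 * (‖z‖ + C * T)) + C)
        from ⟨h, key _ hi h⟩
      have h3 : ‖∫ s in (i * (T / n))..((i + 1) * (T / n)), M s (hsEuler M (T / n) z i)‖ ≤
          (e * (2 * (‖z‖ + C * T)) + C) * |(i + 1) * (T / n) - i * (T / n)| := by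
        apply intervalIntegral.norm_integral_le_of_norm_le_const
        intro s hs
        rw [uIoc_of_le (by gcongr; linarith)] at hs
        have h6 : ((i:ℝ) + 1) * (T / n) ≤ T := by
          have : (i:ℝ) + 1 ≤ n := by exact_mod_cast hi
          calc ((i:ℝ) + 1) * (T / n) ≤ n * (T / n) := by gcongr
            _ = T := by field_simp
        have hs1 : s ∈ Icc 0 T := ⟨by
          have := hs.1; have : 0 ≤ i * (T / n) := by positivity
          linarith, by linarith [hs.2]⟩
        refine (hgr s hs1 _).trans ?_
        gcongr
      have h4 : |(i + 1) * (T / n) - i * (T / n)| = T / n := by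
        rw [show ((i:ℝ) + 1) * (T / n) - i * (T / n) = T / n by ring]
        exact abs_of_pos (by positivity)
      rw [h4] at h3
      simp only [hsEuler]
      rw [add_sub_right_comm]
      refine (norm_add_le _ _).trans ?_
      push_cast
      nlinarith
  -- fixed points
  set C' : ℝ := ‖Λ‖ * (T * (e * (2 * (C * T)) + C)) with hC'
  have hfix : ∀ n : ℕ, 0 < n → ∃ z : ℂ, ‖z‖ ≤ 2 * C' ∧ z = Λ (hsEuler M (T / n) z n - z) := by
    intro n hn
    have hn' : (0:ℝ) < n := by exact_mod_cast hn
    have hbd : ∀ z, ‖Λ (hsEuler M (T / n) z n - z)‖ ≤ ‖z‖ / 2 + C' := by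
      intro z
      refine (Λ.le_opNorm _).trans ?_
      have h1 := (hEb n hn z n le_rfl).1
      rw [show (n:ℝ) * (T / n) = T by field_simp] at h1
      calc ‖Λ‖ * ‖hsEuler M (T / n) z n - z‖ ≤ ‖Λ‖ * (T * (e * (2 * (‖z‖ + C * T)) + C)) := by gcongr
        _ = 2 * (‖Λ‖ * T * e) * ‖z‖ + C' := by rw [hC']; ring
        _ ≤ _ := by nlinarith [norm_nonneg z]
    obtain ⟨z, hz⟩ := hs_brouwer (fun z => Λ (hsEuler M (T / n) z n - z))
      (Λ.continuous.comp ((hsEuler_continuous M T hM hMc e C hepos.le hgr (T / n) (by positivity) n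
        (by field_simp; exact le_rfl)).sub continuous_id)) C' hbd
    refine ⟨z, ?_, hz.symm⟩
    have := hbd z
    rw [hz] at this
    linarith
  have hC'0 : 0 ≤ C' := by positivity
  set m : ℝ := 2 * (2 * C' + C * T) with hm
  set K : ℝ := e * m + C with hK
  have hK0 : 0 ≤ K := by positivity
  choose! zz hzz1 hzz2 using hfix
  -- step functions
  let S : ℕ → ℝ → ℂ := fun n s => hsEuler M (T / n) (zz n) ⌊s / (T / n)⌋₊
  have hSm : ∀ n, Measurable (S n) := by
    intro n
    have h1 : Measurable fun s : ℝ => ⌊s / (T / n)⌋₊ := Nat.measurable_floor.comp (measurable_id.div_const _)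
    exact (measurable_from_nat (f := hsEuler M (T / n) (zz n))).comp h1
  have hMSm : ∀ n, Measurable fun s => M s (S n s) := fun n =>
    hM.comp (measurable_id.prodMk (hSm n))
  have hEm : ∀ n : ℕ, 0 < n → ∀ i ≤ n, ‖hsEuler M (T / n) (zz n) i‖ ≤ m := by
    intro n hn i hi
    refine (hEb n hn _ i hi).2.trans ?_
    rw [hm]; have := hzz1 n hn; gcongr
  have hSb : ∀ n : ℕ, 0 < n → ∀ s ∈ Icc 0 T, ‖S n s‖ ≤ m := by
    intro n hn s hs
    have hn' : (0:ℝ) < n := by exact_mod_cast hn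
    apply hEm n hn
    apply Nat.floor_le_of_le
    rw [div_le_iff₀ (by positivity)]
    have : (n:ℝ) * (T / n) = T := by field_simp
    rw [this]; exact hs.2
  have hMSb : ∀ n : ℕ, 0 < n → ∀ s ∈ Icc 0 T, ‖M s (S n s)‖ ≤ K := by
    intro n hn s hs
    refine (hgr s hs _).trans ?_
    have := hSb n hn s hs
    rw [hK]; gcongr
  have hint : ∀ n : ℕ, 0 < n → ∀ a ∈ Icc 0 T, ∀ b ∈ Icc 0 T,
      IntervalIntegrable (fun s => M s (S n s)) volume a b := by
    intro n hn a ha b hb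
    refine hs_intervalIntegrable _ (hMSm n) K a b fun s hs => hMSb n hn s ?_
    have := uIoc_subset_uIcc hs
    exact (convex_Icc 0 T).ordConnected.uIcc_subset ha hb this
  let Z : ℕ → ℝ → ℂ := fun n t => zz n + ∫ s in (0:ℝ)..t, M s (S n s)
  have h0 : (0:ℝ) ∈ Icc 0 T := ⟨le_rfl, hT.le⟩
  have hTm : T ∈ Icc 0 T := ⟨hT.le, le_rfl⟩
  have hZL : ∀ n : ℕ, 0 < n → ∀ a ∈ Icc 0 T, ∀ b ∈ Icc 0 T, ‖Z n b - Z n a‖ ≤ K * |b - a| := by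
    intro n hn a ha b hb
    have : Z n b - Z n a = ∫ s in a..b, M s (S n s) := by
      simp only [Z]
      rw [add_sub_add_left_eq_sub, intervalIntegral.integral_interval_sub_left (hint n hn 0 h0 b hb) (hint n hn 0 h0 a ha)]
    rw [this]
    apply intervalIntegral.norm_integral_le_of_norm_le_const
    intro s hs
    exact hMSb n hn s ((convex_Icc 0 T).ordConnected.uIcc_subset ha hb (uIoc_subset_uIcc hs))
  have hmem : ∀ n : ℕ, 0 < n → ∀ i : ℕ, i ≤ n → (i:ℝ) * (T / n) ∈ Icc 0 T := by
    intro n hn i hi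
    have hn' : (0:ℝ) < n := by exact_mod_cast hn
    refine ⟨by positivity, ?_⟩
    have : (i:ℝ) ≤ n := by exact_mod_cast hi
    calc (i:ℝ) * (T / n) ≤ n * (T / n) := by gcongr
      _ = T := by field_simp
  have hZE : ∀ n : ℕ, 0 < n → ∀ i : ℕ, i ≤ n → Z n (i * (T / n)) = hsEuler M (T / n) (zz n) i := by
    intro n hn i hi
    have hn' : (0:ℝ) < n := by exact_mod_cast hn
    induction i with
    | zero => simp [Z, hsEuler]
    | succ i ih =>
      have ih := ih (by omega)
      simp only [hsEuler]
      rw [← ih]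
      simp only [Z]
      rw [add_assoc]
      congr 1
      rw [← intervalIntegral.integral_add_adjacent_intervals (hint n hn 0 h0 _ (hmem n hn i (by omega)))
        (hint n hn _ (hmem n hn i (by omega)) _ (hmem n hn (i+1) hi))]
      congr 1
      push_cast
      have hle : (i:ℝ) * (T / n) ≤ (i + 1) * (T / n) := by gcongr; linarith
      rw [intervalIntegral.integral_of_le hle, intervalIntegral.integral_of_le hle,
        integral_Ioc_eq_integral_Ioo, integral_Ioc_eq_integral_Ioo]
      refine setIntegral_congr_fun measurableSet_Ioo fun s hs => ?_
      simp only [S]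
      have hfl : ⌊s / (T / n)⌋₊ = i := by
        rw [Nat.floor_eq_iff (by have := hs.1; have : 0 ≤ i * (T / n) := by positivity
                                 have : 0 ≤ s := by linarith
                                 positivity)]
        constructor
        · rw [le_div_iff₀ (by positivity)]; exact hs.1.le
        · rw [div_lt_iff₀ (by positivity)]; exact hs.2
      rw [hfl, ← ih]
  have hSZ : ∀ n : ℕ, 0 < n → ∀ s ∈ Icc 0 T, ‖S n s - Z n s‖ ≤ K * (T / n) := by
    intro n hn s hs
    have hn' : (0:ℝ) < n := by exact_mod_cast hn
    have hp : 0 < T / n := by positivity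
    have hi : ⌊s / (T / n)⌋₊ ≤ n := by
      apply Nat.floor_le_of_le
      rw [div_le_iff₀ (by positivity)]
      have : (n:ℝ) * (T / n) = T := by field_simp
      rw [this]; exact hs.2
    simp only [S]
    rw [← hZE n hn _ hi]
    refine (hZL n hn _ hs _ (hmem n hn _ hi)).trans ?_
    gcongr
    have h1 := Nat.floor_le (div_nonneg hs.1 hp.le)
    have h2 := Nat.lt_floor_add_one (s / (T / n))
    rw [le_div_iff₀ hp] at h1
    rw [div_lt_iff₀ hp] at h2
    rw [abs_le]; constructor <;> nlinarith
  have hZb : ∀ n : ℕ, 0 < n → ∀ s ∈ Icc 0 T, ‖Z n s‖ ≤ m + K * T := by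
    intro n hn s hs
    have h1 := hZL n hn 0 h0 s hs
    have h2 : Z n 0 = zz n := by simp [Z]
    have h3 := hEm n hn 0 (by omega)
    simp only [hsEuler] at h3
    have h4 := norm_add_le (Z n s - Z n 0) (Z n 0)
    simp only [sub_add_cancel] at h4
    rw [h2] at h4 h1
    have h5 : K * |s - 0| ≤ K * T := by
      gcongr
      rw [sub_zero, abs_of_nonneg hs.1]; exact hs.2
    linarith
  -- Arzela-Ascoli
  let A : Set (BoundedContinuousFunction (Icc (0:ℝ) T) ℂ) :=
    {f | (∀ x, ‖f x‖ ≤ m + K * T) ∧ ∀ x y, dist (f x) (f y) ≤ K * dist x y}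
  have hAc : IsCompact A := by
    refine BoundedContinuousFunction.arzela_ascoli₂ (Metric.closedBall 0 (m + K * T)) (isCompact_closedBall _ _) A ?_ ?_ ?_
    · have : A = (⋂ x, {f | ‖f x‖ ≤ m + K * T}) ∩ (⋂ x, ⋂ y, {f | dist (f x) (f y) ≤ K * dist x y}) := by
        ext f; simp only [A, mem_inter_iff, mem_iInter, mem_ofPred_eq]
      rw [this]
      have hev : ∀ x, Continuous fun f : BoundedContinuousFunction (Icc (0:ℝ) T) ℂ => f x :=
        fun x => continuous_eval_const x
      refine (isClosed_iInter fun x => isClosed_le (hev x).norm continuous_const).inter ?_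
      exact isClosed_iInter fun x => isClosed_iInter fun y =>
        isClosed_le ((hev x).dist (hev y)) continuous_const
    · intro f x hf
      simpa using hf.1 x
    · apply Metric.equicontinuous_of_continuity_modulus (fun d => K * d)
      · have : Tendsto (fun d : ℝ => K * d) (nhds 0) (nhds (K * 0)) := (continuous_const.mul continuous_id).tendsto 0
        simpa using this
      · intro x y f
        exact f.2.2 x y
  have hZc : ∀ n : ℕ, 0 < n → Continuous fun x : Icc (0:ℝ) T => Z n x := by
    intro n hn
    refine LipschitzWith.continuous (K := K.toNNReal) (LipschitzWith.of_dist_le_mul fun x y => ?_)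
    rw [Real.coe_toNNReal _ hK0, dist_eq_norm]
    exact hZL n hn y y.2 x x.2
  let f : ℕ → BoundedContinuousFunction (Icc (0:ℝ) T) ℂ := fun n =>
    BoundedContinuousFunction.mkOfCompact ⟨fun x => Z (n+1) x, hZc (n+1) (by omega)⟩
  have hfA : ∀ n, f n ∈ A := by
    intro n
    refine ⟨fun x => hZb (n+1) (by omega) x x.2, fun x y => ?_⟩
    rw [dist_eq_norm]
    exact hZL (n+1) (by omega) y y.2 x x.2
  obtain ⟨w, hwA, φ, hφ, hlim⟩ := hAc.tendsto_subseq hfA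
  let W : ℝ → ℂ := Set.IccExtend hT.le w
  have hWc : Continuous W := w.continuous.Icc_extend'
  have hWw : ∀ t (ht : t ∈ Icc 0 T), W t = w ⟨t, ht⟩ := fun t ht => IccExtend_of_mem _ _ ht
  have hpt : ∀ t ∈ Icc 0 T, Tendsto (fun n => Z (φ n + 1) t) atTop (nhds (W t)) := by
    intro t ht
    rw [hWw t ht]
    exact ((continuous_eval_const (F := BoundedContinuousFunction (Icc (0:ℝ) T) ℂ) (⟨t, ht⟩ : Icc (0:ℝ) T)).tendsto w).comp hlim
  have hSpt : ∀ t ∈ Icc 0 T, Tendsto (fun n => S (φ n + 1) t) atTop (nhds (W t)) := by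
    intro t ht
    have h1 : Tendsto (fun n => S (φ n + 1) t - Z (φ n + 1) t) atTop (nhds 0) := by
      refine squeeze_zero_norm (a := fun n => K * (T / ((φ n + 1 : ℕ) : ℝ))) (fun n => hSZ _ (by omega) t ht) ?_
      have h2 : Tendsto (fun n => φ n + 1) atTop atTop := (tendsto_add_atTop_nat 1).comp hφ.tendsto_atTop
      have h3 := (tendsto_const_div_atTop_nhds_zero_nat T).comp h2
      simpa using h3.const_mul K
    simpa using h1.add (hpt t ht)
  have hIlim : ∀ t ∈ Icc 0 T, Tendsto (fun n => ∫ s in (0:ℝ)..t, M s (S (φ n + 1) s)) atTop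
      (nhds (∫ s in (0:ℝ)..t, M s (W s))) := by
    intro t ht
    have hsub : Set.uIoc 0 t ⊆ Icc 0 T := by
      rw [uIoc_of_le ht.1]; exact fun s hs => ⟨hs.1.le, hs.2.trans ht.2⟩
    refine intervalIntegral.tendsto_integral_filter_of_dominated_convergence (fun _ => K) ?_ ?_ ?_ ?_
    · exact Eventually.of_forall fun n => (hMSm _).aestronglyMeasurable
    · exact Eventually.of_forall fun n => Eventually.of_forall fun s hs => hMSb _ (by omega) s (hsub hs)
    · exact intervalIntegrable_const
    · exact Eventually.of_forall fun s hs => ((hMc s).tendsto _).comp (hSpt s (hsub hs))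
  have hzlim : Tendsto (fun n => zz (φ n + 1)) atTop (nhds (W 0)) := by
    have := hpt 0 h0
    simpa [Z] using this
  refine ⟨W, hWc, fun t ht => ?_, ?_⟩
  · exact tendsto_nhds_unique (hpt t ht) (hzlim.add (hIlim t ht))
  · refine tendsto_nhds_unique hzlim (((Λ.continuous.tendsto _).comp (hIlim T hTm)).congr fun n => ?_)
    have hp : 0 < φ n + 1 := by omega
    have h1 := hzz2 _ hp
    have h2 := hZE _ hp _ le_rfl
    have hn' : (0:ℝ) < ((φ n + 1 : ℕ) : ℝ) := by exact_mod_cast hp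
    rw [show ((φ n + 1 : ℕ) : ℝ) * (T / ((φ n + 1 : ℕ) : ℝ)) = T by field_simp] at h2
    rw [← h2] at h1
    rw [h1]
    simp [Z]

theorem hs_growth (g : ℝ → ℝ) (hgc : Continuous g) (hg0 : CondG0 g) :
    ∀ e > 0, ∃ C, 0 ≤ C ∧ ∀ x, |g x| ≤ e * |x| + C := by
  intro e he
  have h1 : ∀ᶠ x in cocompact ℝ, |g x / x| < e := by
    have := (Metric.tendsto_nhds.1 hg0) e he
    exact this.mono fun x hx => by rwa [dist_zero_right, Real.norm_eq_abs] at hx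
  obtain ⟨t, ht, hts⟩ := mem_cocompact.1 h1
  obtain ⟨C, hC⟩ := ht.exists_bound_of_continuousOn hgc.continuousOn
  refine ⟨max C |g 0|, le_max_of_le_right (abs_nonneg _), fun x => ?_⟩
  by_cases hx0 : x = 0
  · subst hx0; simp
  by_cases hx : x ∈ t
  · have := hC x hx
    rw [Real.norm_eq_abs] at this
    have h2 := le_max_left C |g 0|
    have : 0 ≤ e * |x| := by positivity
    linarith
  · have h2 : |g x / x| < e := hts hx
    rw [abs_div, div_lt_iff₀ (abs_pos.2 hx0)] at h2
    have h3 := le_max_right C |g 0|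
    have h4 := abs_nonneg (g 0)
    linarith

theorem hs_bvp (g : ℝ → ℝ) (hgc : Continuous g)
    (hgr : ∀ e > 0, ∃ C, 0 ≤ C ∧ ∀ x, |g x| ≤ e * |x| + C)
    (p : ℝ × ℝ × ℝ → ℝ) (hp : Continuous p) (B : ℝ) (hB : ∀ z, |p z| ≤ B)
    (c : ℝ → ℝ) (hcm : Measurable c) (hc1 : ∀ s, 1 ≤ c s) (b T : ℝ) (hT : 0 < T)
    (μ : ℝ) (hμ1 : μ < 1) :
    ∃ u v : ℝ → ℝ, Continuous u ∧ Continuous v ∧ u T = μ * u 0 ∧ v T = μ * v 0 ∧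
      ∀ s ∈ Ioo 0 T, ContinuousAt c s → HasDerivAt u (v s) s ∧
        HasDerivAt v ((c s)⁻¹ * (-g (c s * u s) + p (b + s, c s * u s, c s * v s))) s := by
  have hB0 : 0 ≤ B := (abs_nonneg _).trans (hB 0)
  have hcp : ∀ s, 0 < c s := fun s => one_pos.trans_le (hc1 s)
  let f : ℝ → ℂ → ℝ := fun s z => (c s)⁻¹ * (-g (c s * (z.re + s * z.im)) +
    p (b + s, c s * (z.re + s * z.im), c s * z.im))
  let M : ℝ → ℂ → ℂ := fun s z => (f s z : ℂ) * (-(s:ℂ) + Complex.I)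
  have hMm : Measurable (Function.uncurry M) := by
    have h1 : Measurable fun q : ℝ × ℂ => c q.1 := hcm.comp measurable_fst
    have h2 : Measurable fun q : ℝ × ℂ => (q.2.re + q.1 * q.2.im) := by fun_prop
    have h3 : Measurable fun q : ℝ × ℂ => q.2.im := by fun_prop
    have h4 : Measurable fun q : ℝ × ℂ => f q.1 q.2 := by
      refine h1.inv.mul (((hgc.measurable.comp (h1.mul h2)).neg).add (hp.measurable.comp ?_))
      exact (measurable_const.add measurable_fst).prodMk ((h1.mul h2).prodMk (h1.mul h3))
    have h5 : Measurable fun q : ℝ × ℂ => (-(q.1:ℂ) + Complex.I) := by fun_prop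
    exact (Complex.measurable_ofReal.comp h4).mul h5
  have hMc : ∀ s, Continuous (M s) := by
    intro s
    have h4 : Continuous fun z => f s z := by
      simp only [f]
      fun_prop
    exact (Complex.continuous_ofReal.comp h4).mul continuous_const
  have hMg : ∀ e > 0, ∃ C, 0 ≤ C ∧ ∀ s ∈ Icc 0 T, ∀ z, ‖M s z‖ ≤ e * ‖z‖ + C := by
    intro e he
    obtain ⟨C, hC, hgC⟩ := hgr (e / ((1 + T) * (1 + T))) (by positivity)
    refine ⟨(C + B) * (1 + T), by positivity, fun s hs z => ?_⟩
    have hn : ‖(-(s:ℂ) + Complex.I)‖ ≤ 1 + T := by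
      refine (norm_add_le _ _).trans ?_
      rw [norm_neg, Complex.norm_real, Real.norm_eq_abs, abs_of_nonneg hs.1, Complex.norm_I]
      linarith [hs.2]
    have hw : |z.re + s * z.im| ≤ (1 + T) * ‖z‖ := by
      have h1 := Complex.abs_re_le_norm z
      have h2 := Complex.abs_im_le_norm z
      have h3 : |s * z.im| ≤ T * ‖z‖ := by
        rw [abs_mul, abs_of_nonneg hs.1]
        exact mul_le_mul hs.2 h2 (abs_nonneg _) hT.le
      have h4 := abs_add_le z.re (s * z.im)
      linarith
    have hf : |f s z| ≤ e / ((1 + T) * (1 + T)) * ((1 + T) * ‖z‖) + (C + B) := by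
      simp only [f]
      rw [abs_mul, abs_of_pos (inv_pos.2 (hcp s)), inv_mul_le_iff₀ (hcp s)]
      have h1 := hgC (c s * (z.re + s * z.im))
      have h2 := hB (b + s, c s * (z.re + s * z.im), c s * z.im)
      have h3 := abs_add_le (-g (c s * (z.re + s * z.im)))
        (p (b + s, c s * (z.re + s * z.im), c s * z.im))
      rw [abs_neg] at h3
      rw [abs_mul, abs_of_pos (hcp s)] at h1
      have h5 : e / ((1 + T) * (1 + T)) * (c s * |z.re + s * z.im|) ≤
          e / ((1 + T) * (1 + T)) * (c s * ((1 + T) * ‖z‖)) := by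
        have := hcp s
        gcongr
      have h6 : C + B ≤ c s * (C + B) := le_mul_of_one_le_left (by positivity) (hc1 s)
      linarith
    calc ‖M s z‖ = |f s z| * ‖(-(s:ℂ) + Complex.I)‖ := by
          simp only [M]; rw [norm_mul, Complex.norm_real, Real.norm_eq_abs]
      _ ≤ (e / ((1 + T) * (1 + T)) * ((1 + T) * ‖z‖) + (C + B)) * (1 + T) := by gcongr
      _ = e * ‖z‖ + (C + B) * (1 + T) := by field_simp
  set α : ℝ := -1 / (1 - μ) with hα
  have hαμ : α * (1 - μ) = -1 := by
    have : (1 - μ) ≠ 0 := by linarith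
    rw [hα]; field_simp
  obtain ⟨W, hWc, hWi, hW0⟩ := hs_main M T hT hMm hMc hMg
    (α • ContinuousLinearMap.id ℝ ℂ +
      (α ^ 2 * T * μ) • (Complex.ofRealCLM.comp Complex.imCLM))
  have hWT := hWi T ⟨hT.le, le_rfl⟩
  set Q := ∫ s in (0:ℝ)..T, M s (W s) with hQ
  have hre0 : (W 0).re = α * Q.re + α ^ 2 * T * μ * Q.im := by
    rw [hW0]; simp [-Complex.ofReal_pow]
  have him0 : (W 0).im = α * Q.im := by
    rw [hW0]; simp [-Complex.ofReal_pow]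
  have hreT : (W T).re = (W 0).re + Q.re := by rw [hWT]; simp
  have himT : (W T).im = (W 0).im + Q.im := by rw [hWT]; simp
  have hre : Continuous fun s => (W s).re := Complex.continuous_re.comp hWc
  have him : Continuous fun s => (W s).im := Complex.continuous_im.comp hWc
  have e2 : (W T).im = μ * (W 0).im := by
    rw [himT, him0]; linear_combination Q.im * hαμ
  refine ⟨fun s => (W s).re + s * (W s).im, fun s => (W s).im, by fun_prop, by fun_prop, ?_, e2, ?_⟩
  · simp only [zero_mul, add_zero]
    rw [e2, hreT, him0, hre0]
    linear_combination (Q.re + α * T * μ * Q.im) * hαμ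
  · intro s hs hcs
    have hWm : Measurable fun s => M s (W s) := hMm.comp (measurable_id.prodMk hWc.measurable)
    have hcont : ContinuousAt (fun s => M s (W s)) s := by
      have h1 : ContinuousAt (fun s => f s (W s)) s := by
        have a1 : ContinuousAt (fun s => (W s).re) s := hre.continuousAt
        have a2 : ContinuousAt (fun s => (W s).im) s := him.continuousAt
        have a3 : ContinuousAt (fun s => c s * ((W s).re + s * (W s).im)) s :=
          hcs.mul (a1.add (continuousAt_id.mul a2))
        have a4 : ContinuousAt (fun s => c s * (W s).im) s := hcs.mul a2
        have a5 : ContinuousAt (fun s => b + s) s := by fun_prop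
        have a6 := hp.continuousAt.comp (a5.prodMk (a3.prodMk a4))
        have a7 := hgc.continuousAt.comp a3
        exact (hcs.inv₀ (hcp s).ne').mul (a7.neg.add a6)
      have h2 : ContinuousAt (fun s : ℝ => (-(s:ℂ) + Complex.I)) s := by fun_prop
      exact (Complex.continuous_ofReal.continuousAt.comp h1).mul h2
    have hbW : ∃ K, ∀ r ∈ Icc 0 T, ‖W r‖ ≤ K :=
      isCompact_Icc.exists_bound_of_continuousOn hWc.continuousOn
    obtain ⟨K, hK⟩ := hbW
    obtain ⟨C, hC, hgC⟩ := hMg 1 one_pos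
    have hii : IntervalIntegrable (fun s => M s (W s)) volume 0 s := by
      refine hs_intervalIntegrable _ hWm (1 * K + C) _ _ fun r hr => ?_
      rw [uIoc_of_le hs.1.le] at hr
      have hr' : r ∈ Icc 0 T := ⟨hr.1.le, hr.2.trans hs.2.le⟩
      have := hgC r hr' (W r)
      have := hK r hr'
      linarith
    have hd : HasDerivAt W (M s (W s)) s := by
      have h1 := intervalIntegral.integral_hasDerivAt_right hii
        hWm.stronglyMeasurable.stronglyMeasurableAtFilter hcont
      have h2 := h1.const_add (W 0)
      refine h2.congr_of_eventuallyEq ?_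
      filter_upwards [Icc_mem_nhds hs.1 hs.2] with r hr
      exact hWi r hr
    have hdre : HasDerivAt (fun s => (W s).re) (-s * f s (W s)) s := by
      have h1 := Complex.reCLM.hasFDerivAt.comp_hasDerivAt s hd
      have h2 : Complex.reCLM (M s (W s)) = -s * f s (W s) := by simp [M]; ring
      rw [h2] at h1; exact h1
    have hdim : HasDerivAt (fun s => (W s).im) (f s (W s)) s := by
      have h1 := Complex.imCLM.hasFDerivAt.comp_hasDerivAt s hd
      have h2 : Complex.imCLM (M s (W s)) = f s (W s) := by simp [M]
      rw [h2] at h1; exact h1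
    refine ⟨?_, hdim⟩
    have := hdre.add ((hasDerivAt_id s).mul hdim)
    refine this.congr_deriv ?_
    simp only [id]; ring

noncomputable def hsC (I : Finset ℤ) (d : ℤ → ℝ) (a : ℝ) (s : ℝ) : ℝ :=
  ∏ i ∈ I, if d i < s then 1 + a else 1

theorem hsC_congr (I : Finset ℤ) (d : ℤ → ℝ) (a : ℝ) (s s' : ℝ)
    (h : ∀ i ∈ I, (d i < s' ↔ d i < s)) : hsC I d a s' = hsC I d a s :=
  Finset.prod_congr rfl fun i hi => by simp only [h i hi]

theorem hsC_left (I : Finset ℤ) (d : ℤ → ℝ) (a : ℝ) (s : ℝ) :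
    ∀ᶠ s' in nhdsWithin s (Iic s), hsC I d a s' = hsC I d a s := by
  have : ∀ᶠ s' in nhdsWithin s (Iic s), ∀ i ∈ I, (d i < s' ↔ d i < s) := by
    rw [Finset.eventually_all]
    intro i _
    by_cases h : d i < s
    · filter_upwards [mem_nhdsWithin_of_mem_nhds (Ioi_mem_nhds h)] with r hr
      exact ⟨fun _ => h, fun _ => hr⟩
    · filter_upwards [self_mem_nhdsWithin] with r hr
      exact ⟨fun h' => h'.trans_le hr, fun h' => absurd h' h⟩
  filter_upwards [this] with r hr
  exact hsC_congr _ _ _ _ _ hr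

theorem hsC_nhds (I : Finset ℤ) (d : ℤ → ℝ) (a : ℝ) (s : ℝ) (hs : ∀ i ∈ I, s ≠ d i) :
    ∀ᶠ s' in nhds s, hsC I d a s' = hsC I d a s := by
  have : ∀ᶠ s' in nhds s, ∀ i ∈ I, (d i < s' ↔ d i < s) := by
    rw [Finset.eventually_all]
    intro i hi
    rcases lt_or_gt_of_ne (hs i hi) with h | h
    · filter_upwards [Iio_mem_nhds h] with r hr
      exact ⟨fun h' => absurd h' (not_lt.2 (le_of_lt hr)), fun h' => absurd h' (not_lt.2 h.le)⟩
    · filter_upwards [Ioi_mem_nhds h] with r hr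
      exact ⟨fun _ => h, fun _ => hr⟩
  filter_upwards [this] with r hr
  exact hsC_congr _ _ _ _ _ hr

theorem hsC_right (I : Finset ℤ) (d : ℤ → ℝ) (a : ℝ) (i₀ : ℤ) (hi₀ : i₀ ∈ I)
    (hinj : ∀ i ∈ I, d i = d i₀ → i = i₀) :
    ∀ᶠ s' in nhdsWithin (d i₀) (Ioi (d i₀)), hsC I d a s' = (1 + a) * hsC I d a (d i₀) := by
  have : ∀ᶠ s' in nhdsWithin (d i₀) (Ioi (d i₀)), ∀ i ∈ I, (d i < s' ↔ d i ≤ d i₀) := by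
    rw [Finset.eventually_all]
    intro i hi
    by_cases h : d i ≤ d i₀
    · filter_upwards [self_mem_nhdsWithin] with r hr
      exact ⟨fun _ => h, fun _ => h.trans_lt hr⟩
    · filter_upwards [mem_nhdsWithin_of_mem_nhds (Iio_mem_nhds (not_le.1 h))] with r hr
      exact ⟨fun h' => absurd h' (not_lt.2 (le_of_lt hr)), fun h' => absurd h' h⟩
  filter_upwards [this] with r hr
  simp only [hsC]
  rw [← Finset.mul_prod_erase I _ hi₀, ← Finset.mul_prod_erase I (fun i => if d i < d i₀ then 1 + a else 1) hi₀]
  simp only [lt_irrefl, if_false, one_mul]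
  rw [if_pos ((hr i₀ hi₀).2 le_rfl)]
  congr 1
  refine Finset.prod_congr rfl fun i hi => ?_
  have hi' := Finset.mem_erase.1 hi
  have : (d i < r ↔ d i < d i₀) := by
    rw [hr i hi'.2]
    exact ⟨fun h => lt_of_le_of_ne h fun h' => hi'.1 (hinj i hi'.2 h'), le_of_lt⟩
  simp only [this]

noncomputable def hsPer (b : ℝ) (X : ℝ → ℝ) (t : ℝ) : ℝ := X (toIocMod Real.two_pi_pos b t - b)

theorem hsPer_eq (b : ℝ) (X : ℝ → ℝ) (t : ℝ) (m : ℤ) (h : t - m * (2 * π) - b ∈ Ioc 0 (2 * π)) :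
    hsPer b X t = X (t - m * (2 * π) - b) := by
  have : toIocMod Real.two_pi_pos b t = t - m * (2 * π) := by
    rw [toIocMod_eq_iff]
    refine ⟨⟨by linarith [h.1], by linarith [h.2]⟩, m, ?_⟩
    simp
  rw [hsPer, this]

theorem hs_exists_m (b t : ℝ) : ∃ m : ℤ, t - m * (2 * π) - b ∈ Ioc 0 (2 * π) := by
  refine ⟨toIocDiv Real.two_pi_pos b t, ?_⟩
  have := toIocMod_mem_Ioc Real.two_pi_pos b t
  have h2 : toIocMod Real.two_pi_pos b t = t - toIocDiv Real.two_pi_pos b t * (2 * π) := by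
    rw [toIocMod, zsmul_eq_mul]
  rw [h2] at this
  exact ⟨by linarith [this.1], by linarith [this.2]⟩

theorem hsPer_left (I : Finset ℤ) (d : ℤ → ℝ) (a b : ℝ) (P : ℝ → ℝ) (hP : Continuous P) (t : ℝ) :
    ContinuousWithinAt (hsPer b fun s => hsC I d a s * P s) (Iic t) t := by
  obtain ⟨m, hm⟩ := hs_exists_m b t
  have hsh : Tendsto (fun r : ℝ => r - m * (2 * π) - b) (nhdsWithin t (Iic t))
      (nhdsWithin (t - m * (2 * π) - b) (Iic (t - m * (2 * π) - b))) := by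
    refine tendsto_nhdsWithin_of_tendsto_nhds_of_eventually_within _ ?_ ?_
    · exact (Continuous.tendsto (by fun_prop) t).mono_left nhdsWithin_le_nhds
    · filter_upwards [self_mem_nhdsWithin] with r hr
      have : r ≤ t := hr
      simp only [mem_Iic]; linarith
  have h1 := hsh.eventually (hsC_left I d a _)
  have h2 : ∀ᶠ r in nhdsWithin t (Iic t), r - m * (2 * π) - b ∈ Ioc 0 (2 * π) := by
    have : t > b + m * (2 * π) := by linarith [hm.1]
    filter_upwards [self_mem_nhdsWithin, mem_nhdsWithin_of_mem_nhds (Ioi_mem_nhds this)] with r hr hr2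
    have : r ≤ t := hr
    have : b + m * (2 * π) < r := hr2
    exact ⟨by linarith, by linarith [hm.2]⟩
  unfold ContinuousWithinAt
  rw [hsPer_eq b _ t m hm]
  have h3 : Tendsto (fun r : ℝ => hsC I d a (t - m * (2 * π) - b) * P (r - m * (2 * π) - b))
      (nhdsWithin t (Iic t)) (nhds (hsC I d a (t - m * (2 * π) - b) * P (t - m * (2 * π) - b))) :=
    (Continuous.tendsto (by fun_prop) t).mono_left nhdsWithin_le_nhds
  refine h3.congr' ?_
  filter_upwards [h1, h2] with r hr1 hr2
  rw [hsPer_eq b _ r m hr2]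
  simp only [hr1]

theorem hsPer_deriv (I : Finset ℤ) (d : ℤ → ℝ) (a b : ℝ) (P : ℝ → ℝ) (t : ℝ) (m : ℤ)
    (hm : t - m * (2 * π) - b ∈ Ioo 0 (2 * π)) (hd : ∀ i ∈ I, t - m * (2 * π) - b ≠ d i)
    (P' : ℝ) (hP : HasDerivAt P P' (t - m * (2 * π) - b)) :
    HasDerivAt (hsPer b fun s => hsC I d a s * P s) (hsC I d a (t - m * (2 * π) - b) * P') t := by
  have hsh : Continuous (fun r : ℝ => r - m * (2 * π) - b) := by fun_prop
  have h1 := (hsh.tendsto t).eventually (hsC_nhds I d a _ hd)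
  have h2 : ∀ᶠ r in nhds t, r - m * (2 * π) - b ∈ Ioc 0 (2 * π) :=
    (hsh.tendsto t).eventually (mem_of_superset (isOpen_Ioo.mem_nhds hm) Ioo_subset_Ioc_self)
  have h3 : HasDerivAt (fun r => P (r - m * (2 * π) - b)) P' t := by
    have h4 : HasDerivAt (fun r : ℝ => r - m * (2 * π) - b) 1 t :=
      ((hasDerivAt_id t).sub_const _).sub_const _
    have h5 := HasDerivAt.comp t hP h4
    rw [mul_one] at h5
    exact h5
  refine (h3.const_mul (hsC I d a (t - m * (2 * π) - b))).congr_of_eventuallyEq ?_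
  filter_upwards [h1, h2] with r hr1 hr2
  rw [hsPer_eq b _ r m hr2]
  simp only [hr1]

theorem hsPer_right_aux (I : Finset ℤ) (d : ℤ → ℝ) (a b : ℝ) (P : ℝ → ℝ) (hP : Continuous P)
    (t : ℝ) (m : ℤ) (hm : t - m * (2 * π) - b ∈ Ico 0 (2 * π)) (l : ℝ)
    (hl : ∀ᶠ s' in nhdsWithin (t - m * (2 * π) - b) (Ioi (t - m * (2 * π) - b)), hsC I d a s' = l) :
    Tendsto (hsPer b fun s => hsC I d a s * P s) (nhdsWithin t (Ioi t))
      (nhds (l * P (t - m * (2 * π) - b))) := by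
  have hsh : Tendsto (fun r : ℝ => r - m * (2 * π) - b) (nhdsWithin t (Ioi t))
      (nhdsWithin (t - m * (2 * π) - b) (Ioi (t - m * (2 * π) - b))) := by
    refine tendsto_nhdsWithin_of_tendsto_nhds_of_eventually_within _ ?_ ?_
    · exact (Continuous.tendsto (by fun_prop) t).mono_left nhdsWithin_le_nhds
    · filter_upwards [self_mem_nhdsWithin] with r hr
      have : t < r := hr
      simp only [mem_Ioi]; linarith
  have h1 := hsh.eventually hl
  have h2 : ∀ᶠ r in nhdsWithin t (Ioi t), r - m * (2 * π) - b ∈ Ioc 0 (2 * π) := by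
    have : t < b + m * (2 * π) + 2 * π := by linarith [hm.2]
    filter_upwards [self_mem_nhdsWithin, mem_nhdsWithin_of_mem_nhds (Iio_mem_nhds this)] with r hr hr2
    have : t < r := hr
    have : r < b + m * (2 * π) + 2 * π := hr2
    exact ⟨by linarith [hm.1], by linarith⟩
  have h3 : Tendsto (fun r : ℝ => l * P (r - m * (2 * π) - b))
      (nhdsWithin t (Ioi t)) (nhds (l * P (t - m * (2 * π) - b))) :=
    (Continuous.tendsto (by fun_prop) t).mono_left nhdsWithin_le_nhds
  refine h3.congr' ?_
  filter_upwards [h1, h2] with r hr1 hr2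
  rw [hsPer_eq b _ r m hr2]
  simp only [hr1]

theorem harmonic_solution_exists
    (k : ℕ) (hk : 1 ≤ k) (tj : ℤ → ℝ)
    (htj0 : 0 ≤ tj 1) (htjk : tj k < 2 * π)
    (htjmono : ∀ i j : ℤ, 1 ≤ i → i < j → j ≤ (k : ℤ) → tj i < tj j)
    (htjper : ∀ j : ℤ, tj (j + k) = tj j + 2 * π)
    (a : ℝ) (ha : 0 < a)
    (g : ℝ → ℝ) (hg : LocallyLipschitz g) (hg0 : CondG0 g) (hg1 : CondG1 g)
    (p : ℝ × ℝ × ℝ → ℝ) (hp : Continuous p)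
    (hpb : ∃ M : ℝ, ∀ z, |p z| ≤ M)
    (hpper : ∀ t x y : ℝ, p (t + 2 * π, x, y) = p (t, x, y)) :
    ∃ x y : ℝ → ℝ, IsSolution tj a g p Set.univ x y ∧
      ∀ t : ℝ, x (t + 2 * π) = x t ∧ y (t + 2 * π) = y t := by
  obtain ⟨B, hB⟩ := hpb
  have hgc : Continuous g := hg.continuous
  set b : ℝ := tj 1 with hb
  set I : Finset ℤ := Finset.Icc 2 (k:ℤ) with hI
  let d : ℤ → ℝ := fun i => tj i - b
  have hπ := Real.two_pi_pos
  have hk' : (1:ℤ) ≤ k := by exact_mod_cast hk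
  have hd : ∀ i ∈ I, d i ∈ Ioo 0 (2 * π) := by
    intro i hi
    rw [hI, Finset.mem_Icc] at hi
    have h1 := htjmono 1 i le_rfl (by omega) hi.2
    have h2 : tj i ≤ tj k := by
      rcases hi.2.lt_or_eq with h | h
      · exact (htjmono i k (by omega) h le_rfl).le
      · rw [h]
    simp only [d]
    exact ⟨by linarith, by linarith⟩
  have hinj : ∀ i₀ ∈ I, ∀ i ∈ I, d i = d i₀ → i = i₀ := by
    intro i₀ hi₀ i hi h
    rw [hI, Finset.mem_Icc] at hi hi₀
    simp only [d] at h
    rcases lt_trichotomy i i₀ with h1 | h1 | h1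
    · have := htjmono i i₀ (by omega) h1 hi₀.2; linarith
    · exact h1
    · have := htjmono i₀ i (by omega) h1 hi.2; linarith
  have hper : ∀ m i : ℤ, tj (i + m * k) = tj i + m * (2 * π) := by
    intro m i
    induction m using Int.induction_on with
    | zero => simp
    | succ n ih =>
      have := htjper (i + n * k)
      rw [show i + ((n:ℤ) + 1) * k = i + n * k + k by ring, this, ih]
      push_cast; ring
    | pred n ih =>
      have := htjper (i + (-(n:ℤ) - 1) * k)
      rw [show i + (-(n:ℤ) - 1) * k + k = i + -(n:ℤ) * k by ring, ih] at this
      push_cast at this ⊢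
      linarith
  have hc1 : ∀ s, 1 ≤ hsC I d a s := by
    intro s
    refine Finset.prod_induction _ (fun x : ℝ => 1 ≤ x)
      (fun _ _ h1 h2 => one_le_mul_of_one_le_of_one_le h1 h2) le_rfl fun i _ => ?_
    split_ifs <;> linarith
  have hcm : Measurable (hsC I d a) := by
    refine Finset.measurable_prod _ fun i _ => ?_
    exact Measurable.ite measurableSet_Ioi measurable_const measurable_const
  have hcT := hc1 (2 * π)
  set μ : ℝ := ((1 + a) * hsC I d a (2 * π))⁻¹ with hμ
  have hμ1 : μ < 1 := inv_lt_one_of_one_lt₀ (by nlinarith)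
  obtain ⟨u, v, huc, hvc, huT, hvT, hder⟩ := hs_bvp g hgc (hs_growth g hgc hg0) p hp B hB
    (hsC I d a) hcm hc1 b (2 * π) hπ μ hμ1
  have hjump : ∀ P : ℝ → ℝ, Continuous P → P (2 * π) = μ * P 0 → ∀ j : ℤ,
      Tendsto (hsPer b fun s => hsC I d a s * P s) (nhdsWithin (tj j) (Ioi (tj j)))
        (nhds ((1 + a) * (hsPer b (fun s => hsC I d a s * P s) (tj j)))) := by
    intro P hP hPT j
    obtain ⟨m, i, hi1, hik, rfl⟩ : ∃ m i : ℤ, 1 ≤ i ∧ i ≤ k ∧ j = i + m * k := by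
      refine ⟨(j - 1) / k, (j - 1) % k + 1, ?_, ?_, ?_⟩
      · have := Int.emod_nonneg (j - 1) (show (k:ℤ) ≠ 0 by omega); omega
      · have := Int.emod_lt_of_pos (j - 1) (show (0:ℤ) < k by omega); omega
      · have := Int.emod_add_mul_ediv (j - 1) k
        linarith
    rw [hper]
    rcases hi1.lt_or_eq with h | h
    · have hiI : i ∈ I := by rw [hI, Finset.mem_Icc]; exact ⟨by omega, hik⟩
      have hdi := hd i hiI
      have hsh : tj i + m * (2 * π) - m * (2 * π) - b = d i := by simp only [d]; ring
      have h1 := hsPer_right_aux I d a b P hP (tj i + m * (2 * π)) m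
        (by rw [hsh]; exact ⟨hdi.1.le, hdi.2⟩) ((1 + a) * hsC I d a (d i))
        (by rw [hsh]; exact hsC_right I d a i hiI (hinj i hiI))
      rw [hsPer_eq b _ _ m (by rw [hsh]; exact ⟨hdi.1, hdi.2.le⟩)]
      rw [hsh] at h1 ⊢
      rw [← mul_assoc (1 + a)]; exact h1
    · subst h
      have hsh : tj 1 + m * (2 * π) - m * (2 * π) - b = 0 := by rw [← hb]; ring
      have hsh' : tj 1 + m * (2 * π) - ((m - 1 : ℤ) : ℝ) * (2 * π) - b = 2 * π := by
        rw [← hb]; push_cast; ring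
      have hc0 : hsC I d a 0 = 1 := by
        refine Finset.prod_eq_one fun i hi => ?_
        rw [if_neg (not_lt.2 (hd i hi).1.le)]
      have h1 := hsPer_right_aux I d a b P hP (tj 1 + m * (2 * π)) m
        (by rw [hsh]; exact ⟨le_rfl, hπ⟩) 1
        (by rw [hsh, ← hc0]
            exact mem_nhdsWithin_of_mem_nhds (hsC_nhds I d a 0 fun i hi => (hd i hi).1.ne))
      rw [hsPer_eq b _ _ (m - 1) (by rw [hsh']; exact ⟨hπ, le_rfl⟩)]
      rw [hsh] at h1
      rw [hsh', hPT]
      have h2 : (1 + a) * (hsC I d a (2 * π) * (μ * P 0)) = 1 * P 0 := by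
        have : (1 + a) * hsC I d a (2 * π) ≠ 0 := by positivity
        rw [hμ]; field_simp
      rw [h2]; exact h1
  refine ⟨hsPer b fun s => hsC I d a s * u s, hsPer b fun s => hsC I d a s * v s,
    ⟨?_, ?_, ?_⟩, ?_⟩
  · intro t _
    rw [univ_inter]
    exact ⟨hsPer_left I d a b u huc t, hsPer_left I d a b v hvc t⟩
  · intro t _ ht
    obtain ⟨m, hm⟩ := hs_exists_m b t
    have hlt : t - m * (2 * π) - b < 2 * π := by
      refine lt_of_le_of_ne hm.2 fun h => ht (1 + (m + 1) * k) ?_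
      rw [hper]; push_cast; linarith
    have hnd : ∀ i ∈ I, t - m * (2 * π) - b ≠ d i := by
      intro i hi h
      apply ht (i + m * k)
      rw [hper]; simp only [d] at h; linarith
    have hmo : t - m * (2 * π) - b ∈ Ioo 0 (2 * π) := ⟨hm.1, hlt⟩
    have hcc : ContinuousAt (hsC I d a) (t - m * (2 * π) - b) :=
      (continuousAt_const (y := hsC I d a (t - m * (2 * π) - b))).congr
        ((hsC_nhds I d a _ hnd).mono fun _ h => h.symm)
    obtain ⟨h1, h2⟩ := hder _ hmo hcc
    have d1 := hsPer_deriv I d a b u t m hmo hnd _ h1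
    have d2 := hsPer_deriv I d a b v t m hmo hnd _ h2
    have hcne : hsC I d a (t - m * (2 * π) - b) ≠ 0 := (one_pos.trans_le (hc1 _)).ne'
    rw [mul_inv_cancel_left₀ hcne] at d2
    have hpm : ∀ x y, p (b + (t - m * (2 * π) - b), x, y) = p (t, x, y) := by
      intro x y
      have hpp : Function.Periodic (fun t => p (t, x, y)) (2 * π) := fun t => hpper t x y
      have := hpp.sub_int_mul_eq (x := t) m
      rw [← this]
      congr 2
      ring
    rw [hpm] at d2
    rw [← hsPer_eq b (fun s => hsC I d a s * v s) t m hm] at d1 d2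
    rw [← hsPer_eq b (fun s => hsC I d a s * u s) t m hm] at d2
    exact ⟨d1.continuousAt.continuousWithinAt, d2.continuousAt.continuousWithinAt,
      d1.hasDerivWithinAt, d2.hasDerivWithinAt⟩
  · intro j _
    exact ⟨hjump u huc huT j, hjump v hvc hvT j⟩
  · intro t
    simp [hsPer]
end

section
/- Let K₋ and K₊ be compact convex subsets of ℝ² with 0 in the interior of K₋ and K₋ contained in the interior of K₊, and let 𝒜 = K₊ \ int(K₋) be the closed annulus bounded by Γ₋ = ∂K₋ and Γ₊ = ∂K₊. Let F : K₊ → ℝ² be continuous, let ε > 0, and let L be a 2×2 real orthogonal matrix with det L = 1. Define E = {z ∈ 𝒜 : ‖F(z)‖ ≤ ‖z‖} and J = {z ∈ 𝒜 : ‖F(z)‖ ≥ ε and ⟨L z, F(z)⟩ = 0}, where ⟨·,·⟩ is the Euclidean inner product. If every continuous path γ : [0, 1] → 𝒜 with γ(0) ∈ Γ₋ and γ(1) ∈ Γ₊ satisfies γ([0, 1]) ∩ (J ∪ E) ≠ ∅, then F has at least one fixed point in K₊. -/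
open Set Matrix RealInnerProductSpace

lemma aux_log {X : Type*} [NormedAddCommGroup X] [NormedSpace ℝ X] (K : Set X)
    (hK : Convex ℝ K) (h0 : (0 : X) ∈ K) (f : X → ℂ) (hf : ContinuousOn f K)
    (hf0 : ∀ x ∈ K, f x ≠ 0) :
    ∃ l : X → ℂ, ContinuousOn l K ∧ ∀ x ∈ K, Complex.exp (l x) = f x := by
  classical
  have hmem : ∀ (t : unitInterval) (x : K), (t : ℝ) • (x : X) ∈ K := fun t x =>
    hK.starConvex h0 |>.smul_mem x.2 t.2.1 t.2.2
  let H : C(unitInterval × K, {z : ℂ // z ≠ 0}) :=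
    ⟨fun p => ⟨f ((p.1 : ℝ) • (p.2 : X)), hf0 _ (hmem _ _)⟩, by
      refine Continuous.subtype_mk ?_ _
      exact hf.comp_continuous (by fun_prop) (fun p => hmem _ _)⟩
  let g : C(K, ℂ) := .const _ (Complex.log (f 0))
  have H0 : ∀ a, H (0, a) =
      (fun z : ℂ ↦ (⟨_, z.exp_ne_zero⟩ : {z : ℂ // z ≠ 0})) (g a) := by
    intro a
    apply Subtype.ext
    simp [H, g, Complex.exp_log (hf0 0 h0)]
  let G := Complex.isCoveringMap_exp.liftHomotopy H g H0
  have hG := Complex.isCoveringMap_exp.liftHomotopy_lifts H g H0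
  refine ⟨fun x => if hx : x ∈ K then G (1, ⟨x, hx⟩) else 0, ?_, ?_⟩
  · rw [continuousOn_iff_continuous_domRestrict]
    have : K.domRestrict (fun x => if hx : x ∈ K then G (1, ⟨x, hx⟩) else 0)
        = fun x : K => G (1, x) := by
      ext x; simp
    rw [this]
    fun_prop
  · intro x hx
    have := congrArg Subtype.val (congrFun hG (1, ⟨x, hx⟩))
    simpa [hx, H, G] using this

lemma aux_noret (q : ℂ → ℂ) (hq : Continuous q) (hq0 : ∀ z, q z ≠ 0) (R : ℝ) (hR : 0 < R)
    (h : ∀ z, ‖z‖ = R → q z = z) : False := by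
  obtain ⟨l, hl, hl'⟩ := aux_log (X := ℂ) univ convex_univ (mem_univ _) q hq.continuousOn
    (fun x _ => hq0 x)
  rw [continuousOn_univ] at hl
  let c : ℝ → ℂ := fun t => R * Complex.exp (t * Complex.I)
  have hc : ∀ t, q (c t) = c t := fun t => h _ (by
    simp [c, Complex.norm_exp_ofReal_mul_I, abs_of_pos hR])
  have hcc : Continuous c := by fun_prop
  -- the difference is a discrete-valued continuous function
  let d : ℝ → ℝ := fun t => ((l (c t)).im - t) / (2 * Real.pi)
  have hd : Continuous d := by fun_prop
  have hdi : ∀ t, ∃ n : ℤ, d t = n := by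
    intro t
    have h1 : Complex.exp (l (c t)) = Complex.exp (Real.log R + t * Complex.I) := by
      rw [hl' _ (mem_univ _), hc, Complex.exp_add, ← Complex.ofReal_exp, Real.exp_log hR]
    rw [Complex.exp_eq_exp_iff_exists_int] at h1
    obtain ⟨n, hn⟩ := h1
    refine ⟨n, ?_⟩
    have := congrArg Complex.im hn
    simp at this
    simp only [d]
    rw [this]
    field_simp
    ring
  choose n hn using hdi
  have hnc : Continuous n := by
    rw [Int.isClosedEmbedding_coe_real.isEmbedding.continuous_iff]
    convert hd using 1
    ext t; simp [hn]
  have h2 : n 0 = n (2 * Real.pi) := PreconnectedSpace.constant inferInstance hnc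
  have h3 : d 0 = d (2 * Real.pi) := by rw [hn, hn, h2]
  have h4 : c (2 * Real.pi) = c 0 := by simp [c]
  simp only [d, h4] at h3
  have := Real.pi_pos
  field_simp at h3
  linarith

lemma aux_beta {X : Type*} [TopologicalSpace X] (B : Set X) (Z W l : X → ℂ)
    (hZ : ContinuousOn Z B) (hW : ContinuousOn W B) (hl : ContinuousOn l B)
    (hZ0 : ∀ x ∈ B, Z x ≠ 0) (hne : ∀ x ∈ B, W x ≠ Z x)
    (hexp : ∀ x ∈ B, Complex.exp (l x) = Z x - W x)
    (a b : ℝ) (hab : a ^ 2 + b ^ 2 = 1)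
    (hB : ∀ x ∈ B, ‖W x‖ ≤ ‖Z x‖ ∨ a * (W x / Z x).re + b * (W x / Z x).im = 0) :
    ∃ β : X → ℂ, ContinuousOn β B ∧ ∀ x ∈ B, Complex.exp (β x) = Z x := by
  have hr1 : ∀ x ∈ B, W x / Z x ≠ 1 := fun x hx h => hne x hx (by
    rwa [div_eq_one_iff_eq (hZ0 x hx)] at h)
  have hB' : ∀ x ∈ B, ‖W x / Z x‖ ≤ 1 ∨ a * (W x / Z x).re + b * (W x / Z x).im = 0 := by
    intro x hx
    refine (hB x hx).imp_left fun h => ?_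
    rw [norm_div]
    exact div_le_one_of_le₀ h (norm_nonneg _)
  have key : ∃ g : ℂ → ℂ, ∀ x ∈ B, ContinuousAt g (W x / Z x) ∧
      Complex.exp (g (W x / Z x)) = 1 - W x / Z x := by
    have small : ∀ r : ℂ, ‖r‖ ≤ 1 → r ≠ 1 → r.re < 1 := by
      intro r h h1
      by_contra! h2
      have h3 : r.re ^ 2 + r.im ^ 2 ≤ 1 := by
        have := Complex.sq_norm r
        rw [Complex.normSq_apply] at this
        nlinarith [norm_nonneg r]
      apply h1
      apply Complex.ext <;> simp <;> nlinarith
    by_cases ha : a = 0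
    · refine ⟨fun r => if r.re < 1 then Complex.log (1 - r)
        else Complex.log (r - 1) + Real.pi * Complex.I, fun x hx => ?_⟩
      have hr := hB' x hx
      have hr1 := hr1 x hx
      generalize W x / Z x = r at hr hr1
      rcases lt_trichotomy r.re 1 with h | h | h
      · constructor
        · have : ContinuousAt (fun r => Complex.log (1 - r)) r :=
            ContinuousAt.clog (by fun_prop) (Or.inl (by simpa using h))
          refine this.congr ?_
          filter_upwards [(isOpen_lt Complex.continuous_re continuous_const).mem_nhds h] with y hy
          rw [if_pos hy]
        · simp only [if_pos h]
          exact Complex.exp_log (sub_ne_zero.2 hr1.symm)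
      · exfalso
        rcases hr with hr | hr
        · exact (small r hr hr1).ne h
        · have hb : b ≠ 0 := by rintro rfl; simp [ha] at hab
          simp [ha, hb] at hr
          exact hr1 (Complex.ext (by simpa) (by simpa))
      · constructor
        · have : ContinuousAt (fun r => Complex.log (r - 1) + Real.pi * Complex.I) r :=
            (ContinuousAt.clog (by fun_prop) (Or.inl (by simpa using h))).add continuousAt_const
          refine this.congr ?_
          filter_upwards [(isOpen_lt continuous_const Complex.continuous_re).mem_nhds h] with y hy
          rw [if_neg (not_lt.2 (le_of_lt hy))]
        · simp only [if_neg (not_lt.2 h.le)]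
          rw [Complex.exp_add, Complex.exp_log (sub_ne_zero.2 hr1), Complex.exp_pi_mul_I]
          ring
    · refine ⟨fun r => Complex.log (1 - r), fun x hx => ⟨?_, 
        Complex.exp_log (sub_ne_zero.2 (hr1 x hx).symm)⟩⟩
      have hr := hB' x hx
      have hr1 := hr1 x hx
      generalize W x / Z x = r at hr hr1
      refine ContinuousAt.clog (by fun_prop) ?_
      rcases hr with hr | hr
      · exact Or.inl (by simpa using small r hr hr1)
      · by_cases him : r.im = 0
        · simp [ha, him] at hr
          exact Or.inl (by simp [hr])
        · exact Or.inr (by simpa using him)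
  obtain ⟨g, hg⟩ := key
  refine ⟨fun x => l x - g (W x / Z x), ?_, ?_⟩
  · refine hl.sub fun x hx => ?_
    exact ContinuousAt.comp_continuousWithinAt (f := fun x => W x / Z x) (hg x hx).1 ((hW x hx).div (hZ x hx) (hZ0 x hx))
  · intro x hx
    rw [Complex.exp_sub, hexp x hx, (hg x hx).2]
    have h1 : Z x - W x ≠ 0 := sub_ne_zero.2 (hne x hx).symm
    have h2 := hZ0 x hx
    have : 1 - W x / Z x = (Z x - W x) / Z x := by field_simp
    rw [this]
    field_simp

lemma aux_sep {X : Type*} [NormedAddCommGroup X] [NormedSpace ℝ X] (Km Kp B : Set X)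
    (hKm : IsClosed Km) (hKp : IsClosed Kp) (hconv : Convex ℝ Kp) (h0 : (0 : X) ∈ interior Km)
    (hsub : Km ⊆ interior Kp) (hBc : IsClosed B) (hB : B ⊆ Kp \ interior Km)
    (hcross : ∀ γ : ℝ → X,
      ContinuousOn γ (Icc 0 1) → γ '' (Icc 0 1) ⊆ Kp \ interior Km →
      γ 0 ∈ frontier Km → γ 1 ∈ frontier Kp →
      (γ '' (Icc 0 1) ∩ B).Nonempty) :
    ∃ U : Set X, (0 : X) ∈ U ∧ U ⊆ Kp ∧ frontier U ⊆ B := by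
  have h0' : (0 : X) ∈ Kp \ B :=
    ⟨interior_subset (hsub (interior_subset h0)), fun h => (hB h).2 h0⟩
  let U : Set X := {x | JoinedIn (Kp \ B) 0 x}
  have hUsub : U ⊆ Kp \ B := fun x hx => hx.target_mem
  have step : ∀ u ∈ U, ∀ p ∈ Kp, ∀ r, Metric.ball u r ⊆ Bᶜ → p ∈ Metric.ball u r → p ∈ U := by
    intro u hu p hp r hr hpr
    refine JoinedIn.trans hu (JoinedIn.of_segment_subset ?_)
    intro y hy
    refine ⟨hconv.segment_subset (hUsub hu).1 hp hy, hr ?_⟩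
    exact (convex_ball u r).segment_subset
      (Metric.mem_ball_self (dist_nonneg.trans_lt hpr)) hpr hy
  have hint : U ⊆ interior Kp := by
    intro x hx
    by_contra hxi
    have hxf : x ∈ frontier Kp := ⟨subset_closure (hUsub hx).1, hxi⟩
    obtain ⟨γ, hγ⟩ := hx
    let T : Set ℝ := Icc 0 1 ∩ γ.extend ⁻¹' Km
    have hTc : IsCompact T := isCompact_Icc.inter_right (hKm.preimage γ.continuous_extend)
    have hTn : T.Nonempty := ⟨0, by simp, by simpa using interior_subset h0⟩
    obtain ⟨s, ⟨hs01, hsK⟩, hsmax⟩ := hTc.exists_isGreatest hTn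
    have hafter : ∀ t, s < t → t ≤ 1 → γ.extend t ∉ Km := fun t h1 h2 h3 =>
      absurd (hsmax ⟨⟨hs01.1.trans h1.le, h2⟩, h3⟩) (not_le.2 h1)
    have hs1 : s < 1 := by
      refine lt_of_le_of_ne hs01.2 ?_
      rintro rfl
      exact hxi (hsub (by simpa using hsK))
    have hsi : γ.extend s ∉ interior Km := by
      intro h
      have h1 := (isOpen_interior.preimage γ.continuous_extend).mem_nhds h
      obtain ⟨r, hr, hr'⟩ := Metric.mem_nhds_iff.1 h1
      let t := min 1 (s + r / 2)
      have ht1 : s < t := lt_min hs1 (by linarith)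
      refine hafter t ht1 (min_le_left _ _) (interior_subset (hr' ?_))
      rw [Metric.mem_ball, Real.dist_eq, abs_of_pos (by linarith)]
      have : t ≤ s + r / 2 := min_le_right _ _
      linarith
    have hmemγ : ∀ t, γ.extend t ∈ Kp \ B := fun t => hγ _
    obtain ⟨y, ⟨t, ht, rfl⟩, hyB⟩ := hcross (fun t => γ.extend (s + t * (1 - s)))
      (by have := γ.continuous_extend; fun_prop)
      (by
        rintro _ ⟨t, ht, rfl⟩
        refine ⟨(hmemγ _).1, ?_⟩
        rcases ht.1.eq_or_lt with h | h
        · simpa [← h] using hsi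
        · exact fun h' => hafter _ (by nlinarith) (by nlinarith [ht.2]) (interior_subset h'))
      (by simpa using ⟨subset_closure hsK, hsi⟩)
      (by simpa using hxf)
    exact (hmemγ _).2 hyB
  have hUo : IsOpen U := by
    rw [Metric.isOpen_iff]
    intro u hu
    have h1 : interior Kp ∩ Bᶜ ∈ nhds u :=
      (isOpen_interior.inter hBc.isOpen_compl).mem_nhds ⟨hint hu, (hUsub hu).2⟩
    obtain ⟨r, hr, hr'⟩ := Metric.mem_nhds_iff.1 h1
    exact ⟨r, hr, fun p hp => step u hu p (interior_subset (hr' hp).1) r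
      (fun y hy => (hr' hy).2) hp⟩
  refine ⟨U, JoinedIn.refl h0', fun x hx => (hUsub hx).1, ?_⟩
  intro p hp
  by_contra hpB
  rw [hUo.frontier_eq] at hp
  apply hp.2
  have hpK : p ∈ Kp := hKp.closure_subset_iff.2 (fun x hx => (hUsub hx).1) hp.1
  obtain ⟨r, hr, hr'⟩ := Metric.mem_nhds_iff.1 (hBc.isOpen_compl.mem_nhds hpB)
  obtain ⟨u, hu, hpu⟩ := Metric.mem_closure_iff.1 hp.1 (r / 2) (by linarith)
  refine step u hu p hpK (r / 2) (fun y hy => hr' ?_) (by simpa using hpu)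
  rw [Metric.mem_ball] at hy ⊢
  have := dist_triangle y u p
  rw [dist_comm u p] at this
  linarith

/-- The twist fixed point theorem of Qian et al. (2015): if every continuous path in the
annulus `𝒜 = K₊ \ int(K₋)` joining the inner boundary `∂K₋` to the outer boundary `∂K₊`
meets `J ∪ E`, then the continuous map `F` has a fixed point in `K₊`. -/
theorem twist_fixed_point
    (Km Kp : Set (EuclideanSpace ℝ (Fin 2)))
    (hKmcomp : IsCompact Km) (hKmconv : Convex ℝ Km)
    (hKpcomp : IsCompact Kp) (hKpconv : Convex ℝ Kp)
    (h0 : (0 : EuclideanSpace ℝ (Fin 2)) ∈ interior Km)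
    (hsub : Km ⊆ interior Kp)
    (F : EuclideanSpace ℝ (Fin 2) → EuclideanSpace ℝ (Fin 2))
    (hF : ContinuousOn F Kp)
    (ε : ℝ) (hε : 0 < ε)
    (L : Matrix (Fin 2) (Fin 2) ℝ)
    (hL : L ∈ Matrix.orthogonalGroup (Fin 2) ℝ) (hLdet : L.det = 1)
    (A E J : Set (EuclideanSpace ℝ (Fin 2)))
    (hA : A = Kp \ interior Km)
    (hE : E = {z ∈ A | ‖F z‖ ≤ ‖z‖})
    (hJ : J = {z ∈ A | ε ≤ ‖F z‖ ∧ ⟪Matrix.toEuclideanLin L z, F z⟫ = 0})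
    (hcross : ∀ γ : ℝ → EuclideanSpace ℝ (Fin 2),
      ContinuousOn γ (Icc 0 1) → γ '' (Icc 0 1) ⊆ A →
      γ 0 ∈ frontier Km → γ 1 ∈ frontier Kp →
      (γ '' (Icc 0 1) ∩ (J ∪ E)).Nonempty) :
    ∃ z ∈ Kp, F z = z := by
  classical
  by_contra! hfix
  let φ : EuclideanSpace ℝ (Fin 2) ≃ₗᵢ[ℝ] ℂ := Complex.orthonormalBasisOneI.repr.symm
  have hφ : ∀ z, φ z = ⟨z 0, z 1⟩ := by
    intro z
    rw [Complex.orthonormalBasisOneI_repr_symm_apply]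
    apply Complex.ext <;> simp
  have hAc : IsClosed A := hA ▸ hKpcomp.isClosed.sdiff isOpen_interior
  have hAK : A ⊆ Kp := hA ▸ sdiff_subset
  have hA0 : ∀ z ∈ A, z ≠ 0 := by
    rintro z hz rfl
    rw [hA] at hz
    exact hz.2 h0
  have hFA : ContinuousOn F A := hF.mono hAK
  have hEc : IsClosed E := by
    rw [hE]
    exact hAc.isClosed_le hFA.norm continuous_norm.continuousOn
  have hJc : IsClosed J := by
    have h1 : IsClosed {z ∈ A | ε ≤ ‖F z‖} := hAc.isClosed_le continuousOn_const hFA.norm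
    have h2 : IsClosed {z ∈ A | ⟪Matrix.toEuclideanLin L z, F z⟫ = 0} := by
      have hc : ContinuousOn (fun z => ⟪Matrix.toEuclideanLin L z, F z⟫) A :=
        ContinuousOn.inner
          (LinearMap.continuous_of_finiteDimensional (Matrix.toEuclideanLin L)).continuousOn hFA
      exact hc.preimage_isClosed_of_isClosed hAc isClosed_singleton
    have : J = {z ∈ A | ε ≤ ‖F z‖} ∩ {z ∈ A | ⟪Matrix.toEuclideanLin L z, F z⟫ = 0} := by
      rw [hJ]; ext z; simp only [mem_ofPred_eq, mem_inter_iff]; tauto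
    rw [this]
    exact h1.inter h2
  have hBA : J ∪ E ⊆ A := by
    rw [hJ, hE]; exact union_subset (sep_subset _ _) (sep_subset _ _)
  obtain ⟨a, b, hab, hLab⟩ : ∃ a b : ℝ, a ^ 2 + b ^ 2 = 1 ∧
      ∀ z w : EuclideanSpace ℝ (Fin 2), ⟪Matrix.toEuclideanLin L z, w⟫
        = a * (z 0 * w 0 + z 1 * w 1) + b * (z 0 * w 1 - z 1 * w 0) := by
    rw [Matrix.mem_orthogonalGroup_iff] at hL
    rw [Matrix.det_fin_two] at hLdet
    have e00 := congrFun (congrFun hL 0) 0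
    have e01 := congrFun (congrFun hL 0) 1
    have e11 := congrFun (congrFun hL 1) 1
    simp [Matrix.mul_apply, Fin.sum_univ_two, Matrix.star_apply] at e00 e01 e11
    have h1 : L 1 1 = L 0 0 := by
      linear_combination (-L 1 1) * e00 + L 0 1 * e01 + L 0 0 * hLdet
    have h2 : L 0 1 = - L 1 0 := by
      linear_combination -L 1 0 * e00 + L 0 0 * e01 - L 0 1 * hLdet
    refine ⟨L 0 0, L 1 0, ?_, ?_⟩
    · rw [h2] at e00; linear_combination e00
    · intro z w
      simp [PiLp.inner_apply, Fin.sum_univ_two, Matrix.toLpLin_apply, Matrix.mulVec, dotProduct,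
        h1, h2]
      ring
  obtain ⟨l, hl, hlexp⟩ := aux_log Kp hKpconv (interior_subset (hsub (interior_subset h0)))
    (fun z => φ z - φ (F z)) (φ.continuous.continuousOn.sub (φ.continuous.comp_continuousOn hF))
    (fun z hz h => hfix z hz (φ.injective (sub_eq_zero.1 h)).symm)
  have hBK := hBA.trans hAK
  obtain ⟨β, hβ, hβexp⟩ := aux_beta (J ∪ E) (fun z => φ z) (fun z => φ (F z)) l
    φ.continuous.continuousOn (φ.continuous.comp_continuousOn (hF.mono hBK)) (hl.mono hBK)
    (fun z hz h => hA0 z (hBA hz) (by simpa using h))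
    (fun z hz h => hfix z (hBK hz) (φ.injective h))
    (fun z hz => hlexp z (hBK hz)) a b hab (by
      intro z hz
      rcases hz with hz | hz
      · right
        have h1 : z ≠ 0 := hA0 z (hBA (Or.inl hz))
        rw [hJ] at hz
        have h2 := hz.2.2
        rw [hLab] at h2
        simp only [Complex.div_re, Complex.div_im, hφ]
        linear_combination (Complex.normSq ⟨z 0, z 1⟩)⁻¹ * h2
      · left
        rw [hE] at hz
        simpa using hz.2)
  obtain ⟨U, hU0, hUK, hUf⟩ := aux_sep Km Kp (J ∪ E) hKmcomp.isClosed hKpcomp.isClosed hKpconv h0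
    hsub (hJc.union hEc) (hA ▸ hBA) (by rw [← hA]; exact hcross)
  obtain ⟨g, hg⟩ := ContinuousMap.exists_restrict_eq (hJc.union hEc)
    (⟨(J ∪ E).domRestrict β, continuousOn_iff_continuous_domRestrict.1 hβ⟩ : C(↥(J ∪ E), ℂ))
  have hg' : ∀ z ∈ J ∪ E, g z = β z := fun z hz => DFunLike.congr_fun hg ⟨z, hz⟩
  obtain ⟨R, hRpos, hR⟩ := hKpcomp.isBounded.exists_pos_norm_lt
  let q : EuclideanSpace ℝ (Fin 2) → ℂ := fun z => if z ∈ U then Complex.exp (g z) else φ z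
  have hq : Continuous q := by
    refine Continuous.if (fun z hz => ?_) (by fun_prop) φ.continuous
    have := hUf hz
    rw [hg' z this, hβexp z this]
  have hq0 : ∀ z, q z ≠ 0 := by
    intro z
    by_cases hz : z ∈ U
    · simp [q, hz]
    · simp only [q, hz, if_false]
      intro h
      rw [map_eq_zero_iff φ φ.injective] at h
      exact hz (h ▸ hU0)
  refine aux_noret (fun c => q (φ.symm c)) (hq.comp φ.symm.continuous) (fun c => hq0 _) R hRpos ?_
  intro c hc
  have : φ.symm c ∉ U := fun h => by
    have := hR _ (hUK h)
    simp [hc] at this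
  simp [q, this]
end

section
/- Suppose g : ℝ → ℝ is locally Lipschitz and satisfies condition (g0), and p : ℝ × ℝ × ℝ → ℝ is continuous and bounded. Then for every (x₀, y₀) ∈ ℝ² there exists a solution (x, y) of the impulsive system (S) defined on all of [0, +∞) with x(0) = x₀ and y(0) = y₀. -/
open Real Set Filter MeasureTheory

open Topology

section Carath

variable {E : Type*} [NormedAddCommGroup E] [NormedSpace ℝ E] [ProperSpace E]

lemma aux_ii (f : ℝ → E) (B : ℝ → ℝ) (hB : Monotone B) (hf : StronglyMeasurable f)
    (hb : ∀ s, ‖f s‖ ≤ B s) (u v : ℝ) : IntervalIntegrable f volume u v := by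
  have h := hB.intervalIntegrable (μ := volume) (a := u) (b := v)
  refine h.mono_fun hf.aestronglyMeasurable ?_
  refine Eventually.of_forall fun s => ?_
  exact (hb s).trans (le_abs_self _)

lemma aux_lip (f : ℝ → E) (B : ℝ → ℝ) (hB : Monotone B) (hf : StronglyMeasurable f)
    (hb : ∀ s, ‖f s‖ ≤ B s) (w0 : E) (T t t' : ℝ) (hT : 0 ≤ T) (ht : t ≤ T) (ht' : t' ≤ T) :
    ‖(w0 + ∫ s in (0:ℝ)..max t 0, f s) - (w0 + ∫ s in (0:ℝ)..max t' 0, f s)‖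
      ≤ B T * |t - t'| := by
  have h0 : 0 ≤ B T := (norm_nonneg _).trans (hb T)
  rw [add_sub_add_left_eq_sub, intervalIntegral.integral_interval_sub_left
    (aux_ii f B hB hf hb _ _) (aux_ii f B hB hf hb _ _)]
  refine (intervalIntegral.norm_integral_le_of_norm_le_const (C := B T) ?_).trans ?_
  · intro s hs
    refine (hb s).trans (hB ?_)
    have := (uIoc_subset_uIcc hs).2
    exact this.trans (sup_le (max_le ht' hT) (max_le ht hT))
  · exact mul_le_mul_of_nonneg_left (abs_max_sub_max_le_abs _ _ _) h0

lemma aux_cont (W : ℝ → E) (B : ℝ → ℝ)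
    (h : ∀ T t t', 0 ≤ T → t ≤ T → t' ≤ T → ‖W t - W t'‖ ≤ B T * |t - t'|) :
    Continuous W := by
  rw [continuous_iff_continuousAt]
  intro t
  rw [ContinuousAt, tendsto_iff_norm_sub_tendsto_zero]
  have h1 : Tendsto (fun s => B (|t| + 1) * |s - t|) (𝓝 t) (𝓝 0) := by
    have : Continuous (fun s => B (|t| + 1) * |s - t|) := by fun_prop
    simpa using this.tendsto t
  refine squeeze_zero' (Eventually.of_forall fun _ => norm_nonneg _) ?_ h1
  filter_upwards [Iio_mem_nhds (show t < |t| + 1 by linarith [le_abs_self t])] with s hs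
  exact h _ _ _ (by positivity) (le_of_lt hs) (by linarith [le_abs_self t])

/-- Tonelli iterates. -/
noncomputable def ton (F : ℝ → E → E) (w0 : E) (h : ℝ) : ℕ → ℝ → E
  | 0 => fun _ => w0
  | (k+1) => fun t => w0 + ∫ s in (0:ℝ)..max t 0, F s (ton F w0 h k (s - h))

lemma ton_cont (F : ℝ → E → E) (B : ℝ → ℝ) (hB : Monotone B) (w0 : E)
    (hm : ∀ w : ℝ → E, Continuous w → StronglyMeasurable fun s => F s (w s))
    (hb : ∀ s z, ‖F s z‖ ≤ B s) (h : ℝ) (k : ℕ) : Continuous (ton F w0 h k) := by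
  induction k with
  | zero => exact continuous_const
  | succ k ih =>
    refine aux_cont _ B fun T t t' hT ht ht' => ?_
    exact aux_lip _ B hB (hm (fun s => ton F w0 h k (s - h)) (by fun_prop))
      (fun s => hb _ _) w0 T t t' hT ht ht'

lemma ton_stab (F : ℝ → E → E) (w0 : E) (h : ℝ) (hh : 0 ≤ h) (k : ℕ) :
    ∀ t ≤ k * h, ton F w0 h (k+1) t = ton F w0 h k t := by
  induction k with
  | zero =>
    intro t ht
    have : max t 0 = 0 := max_eq_right (by simpa using ht)
    simp [ton, this]
  | succ k ih =>
    intro t ht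
    show w0 + ∫ s in (0:ℝ)..max t 0, F s (ton F w0 h (k+1) (s - h)) =
      w0 + ∫ s in (0:ℝ)..max t 0, F s (ton F w0 h k (s - h))
    congr 1
    apply intervalIntegral.integral_congr
    intro s hs
    rw [uIcc_of_le (le_max_right _ _)] at hs
    have h2 : s ≤ (k+1) * h := hs.2.trans (max_le (by exact_mod_cast ht) (by positivity))
    show F s _ = F s _
    rw [ih (s - h) (by linarith)]

lemma carath (F : ℝ → E → E) (B : ℝ → ℝ) (hB : Monotone B) (w0 : E)
    (hm : ∀ w : ℝ → E, Continuous w → StronglyMeasurable fun s => F s (w s))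
    (hc : ∀ s, Continuous (F s))
    (hb : ∀ s z, ‖F s z‖ ≤ B s) :
    ∃ w : ℝ → E, Continuous w ∧ ∀ t, w t = w0 + ∫ s in (0:ℝ)..max t 0, F s (w s) := by
  obtain ⟨W, V, hV, hW, hVW⟩ : ∃ W V : ℕ → ℝ → E, (∀ n, Continuous (V n)) ∧
      (∀ n t, W n t = w0 + ∫ s in (0:ℝ)..max t 0, F s (V n s)) ∧
      (∀ (n : ℕ) (s : ℝ), s ≤ n → V n s = W n (s - 1 / ((n:ℝ)+1))) := by
    refine ⟨fun n => ton F w0 (1 / ((n:ℝ)+1)) ((n+1)^2+1),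
      fun n s => ton F w0 (1 / ((n:ℝ)+1)) ((n+1)^2) (s - 1 / ((n:ℝ)+1)), ?_, ?_, ?_⟩
    · intro n
      have := ton_cont F B hB w0 hm hb (1 / ((n:ℝ)+1)) ((n+1)^2)
      fun_prop
    · intro n t
      rfl
    · intro n s hs
      refine (ton_stab F w0 _ (by positivity) _ _ ?_).symm
      have h1 : (((n+1)^2 : ℕ) : ℝ) * (1 / ((n:ℝ)+1)) = n + 1 := by
        push_cast; field_simp
      rw [h1]
      have : 0 < 1 / ((n:ℝ)+1) := by positivity
      linarith
  have hlip : ∀ n T t t', 0 ≤ T → t ≤ T → t' ≤ T → ‖W n t - W n t'‖ ≤ B T * |t - t'| := by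
    intro n T t t' hT ht ht'
    rw [hW, hW]
    exact aux_lip _ B hB (hm _ (hV n)) (fun s => hb _ _) w0 T t t' hT ht ht'
  have hbd : ∀ n t, W n t ∈ Metric.closedBall w0 (B (max t 0) * |t|) := by
    intro n t
    have h0 : W n 0 = w0 := by rw [hW]; simp
    have := hlip n (max t 0) t 0 (le_max_right _ _) (le_max_left _ _) (le_max_right _ _)
    rw [h0, sub_zero] at this
    rwa [mem_closedBall_iff_norm]
  -- subsequence converging on rationals
  obtain ⟨q, -, φ, hφ, hq⟩ := (isCompact_univ_pi (fun r : ℚ =>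
    isCompact_closedBall w0 (B (max (r:ℝ) 0) * |(r:ℝ)|))).tendsto_subseq
    (x := fun n => fun r : ℚ => W n r) (fun n r _ => hbd n r)
  rw [tendsto_pi_nhds] at hq
  have hcv : ∀ t, ∃ l, Tendsto (fun n => W (φ n) t) atTop (𝓝 l) := by
    intro t
    refine cauchySeq_tendsto_of_complete ?_
    rw [Metric.cauchySeq_iff]
    intro ε hε
    set T := |t| + 1 with hT
    have hT0 : 0 ≤ T := by positivity
    have hBT : 0 ≤ B T := (norm_nonneg _).trans (hb T w0)
    set δ := min 1 (ε / (4 * (B T + 1))) with hδ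
    have hδ0 : 0 < δ := by positivity
    obtain ⟨r, hr1, hr2⟩ := exists_rat_btwn (show t - δ < t by linarith)
    have hCr := (hq r).cauchySeq
    rw [Metric.cauchySeq_iff] at hCr
    obtain ⟨N, hN⟩ := hCr (ε / 2) (by positivity)
    refine ⟨N, fun m hm' n hn => ?_⟩
    have h1 : ∀ m, dist (W m t) (W m r) < ε / 4 := by
      intro m
      rw [dist_eq_norm]
      have h2 := hlip m T t r hT0 (by linarith [le_abs_self t]) (by linarith [le_abs_self t])
      have h3 : |t - r| ≤ ε / (4 * (B T + 1)) := by
        rw [abs_of_pos (by linarith)]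
        linarith [min_le_right 1 (ε / (4 * (B T + 1)))]
      calc _ ≤ B T * |t - r| := h2
        _ ≤ B T * (ε / (4 * (B T + 1))) := by gcongr
        _ < (B T + 1) * (ε / (4 * (B T + 1))) := by
            have : 0 < ε / (4 * (B T + 1)) := by positivity
            nlinarith
        _ = ε / 4 := by field_simp
    have h4 := hN m hm' n hn
    simp only [Function.comp] at h4
    have h5 := dist_triangle4 (W (φ m) t) (W (φ m) r) (W (φ n) r) (W (φ n) t)
    have h6 := h1 (φ m)
    have h7 := h1 (φ n)
    rw [dist_comm] at h7
    linarith
  choose w hw using hcv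
  have hwl : ∀ T t t', 0 ≤ T → t ≤ T → t' ≤ T → ‖w t - w t'‖ ≤ B T * |t - t'| := by
    intro T t t' hT ht ht'
    exact le_of_tendsto ((hw t).sub (hw t')).norm
      (Eventually.of_forall fun n => hlip (φ n) T t t' hT ht ht')
  have hwc := aux_cont w B hwl
  refine ⟨w, hwc, fun t => ?_⟩
  have hVc : ∀ s, Tendsto (fun n => V (φ n) s) atTop (𝓝 (w s)) := by
    intro s
    have hφ' := hφ.tendsto_atTop
    have h1 : ∀ᶠ n in atTop, V (φ n) s = W (φ n) (s - 1 / ((φ n : ℝ)+1)) := by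
      have : ∀ᶠ n : ℕ in atTop, s ≤ n := tendsto_natCast_atTop_atTop.eventually_ge_atTop s
      filter_upwards [hφ'.eventually this] with n hn
      exact hVW _ _ hn
    rw [tendsto_congr' h1]
    have h2 : Tendsto (fun n => W (φ n) (s - 1 / ((φ n : ℝ)+1)) - W (φ n) s) atTop (𝓝 0) := by
      have h3 : Tendsto (fun n => B |s| * (1 / ((φ n : ℝ)+1))) atTop (𝓝 0) := by
        have := (tendsto_one_div_add_atTop_nhds_zero_nat (𝕜 := ℝ)).comp hφ'
        simpa using this.const_mul (B |s|)
      refine squeeze_zero_norm (fun n => ?_) h3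
      have h4 : 0 < 1 / ((φ n : ℝ)+1) := by positivity
      have := hlip (φ n) |s| (s - 1 / ((φ n : ℝ)+1)) s (abs_nonneg _)
        (by linarith [le_abs_self s]) (le_abs_self s)
      rwa [show s - 1 / ((φ n : ℝ)+1) - s = - (1 / ((φ n : ℝ)+1)) by ring, abs_neg,
        abs_of_pos h4] at this
    simpa using h2.add (hw s)
  refine tendsto_nhds_unique (hw t) ?_
  simp_rw [hW]
  refine Tendsto.const_add _ ?_
  refine intervalIntegral.tendsto_integral_filter_of_dominated_convergence B ?_ ?_ ?_ ?_
  · exact Eventually.of_forall fun n => (hm _ (hV _)).aestronglyMeasurable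
  · exact Eventually.of_forall fun n => Eventually.of_forall fun s _ => hb _ _
  · exact hB.intervalIntegrable
  · exact Eventually.of_forall fun s _ => ((hc s).tendsto _).comp (hVc s)

end Carath

/-- clipping -/
def clip (R u : ℝ) : ℝ := max (-R) (min R u)

lemma clip_abs {R : ℝ} (hR : 0 ≤ R) (u : ℝ) : |clip R u| ≤ R := by
  rw [abs_le]
  exact ⟨le_max_left _ _, max_le (by linarith) (min_le_left _ _)⟩

lemma clip_eq {R u : ℝ} (h : |u| ≤ R) : clip R u = u := by
  rw [abs_le] at h
  rw [clip, min_eq_right h.2, max_eq_right h.1]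

lemma growth_g (g : ℝ → ℝ) (hg : Continuous g) (hg0 : CondG0 g) :
    ∃ C, 0 ≤ C ∧ ∀ x, |g x| ≤ C + |x| := by
  have h1 : ∀ᶠ x in cocompact ℝ, |g x / x| < 1 := by
    have := hg0.abs
    rw [abs_zero] at this
    exact this.eventually (Iio_mem_nhds one_pos)
  obtain ⟨K, hK, hKs⟩ := Filter.mem_cocompact.1 h1
  obtain ⟨C, hC⟩ := (hK.insert 0).exists_bound_of_continuousOn hg.continuousOn
  refine ⟨C, (norm_nonneg _).trans (hC 0 (mem_insert _ _)), fun x => ?_⟩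
  by_cases hx : x ∈ insert 0 K
  · have := hC x hx
    rw [Real.norm_eq_abs] at this
    linarith [abs_nonneg x]
  · rw [mem_insert_iff, not_or] at hx
    have h2 : |g x / x| < 1 := hKs hx.2
    have h3 := (norm_nonneg _).trans (hC 0 (mem_insert _ _))
    rw [abs_div, div_lt_one (abs_pos.2 hx.1)] at h2
    linarith

/-- Global solution of the impulse-free transformed system. -/
lemma transformed (g : ℝ → ℝ) (hg : Continuous g) (hg0 : CondG0 g)
    (p : ℝ × ℝ × ℝ → ℝ) (hp : Continuous p) (hpb : ∃ M : ℝ, ∀ z, |p z| ≤ M)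
    (c : ℝ → ℝ) (hcm : Monotone c) (hc1 : ∀ t, 1 ≤ c t) (x₀ y₀ : ℝ) :
    ∃ w : ℝ → ℝ × ℝ, Continuous w ∧ w 0 = (x₀, y₀) ∧
      ∀ t, 0 ≤ t → (∀ᶠ s in 𝓝 t, c s = c t) →
        HasDerivWithinAt w ((w t).2, (c t)⁻¹ * (-g (c t * (w t).1)
          + p (t, c t * (w t).1, c t * (w t).2))) (Ici 0) t := by
  obtain ⟨C, hC0, hC⟩ := growth_g g hg hg0
  obtain ⟨M, hM⟩ := hpb
  have hM0 : 0 ≤ M := (abs_nonneg _).trans (hM 0)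
  set A := 1 + C + M with hA
  have hA1 : 1 ≤ A := by linarith
  set L := ‖((x₀, y₀) : ℝ × ℝ)‖ with hL
  have hL0 : 0 ≤ L := norm_nonneg _
  set R : ℝ → ℝ := fun s => (1 + L) * exp (A * max s 0) - 1 with hR
  have hRm : Monotone R := by
    intro s t hst
    simp only [hR]
    gcongr
  have hR0 : ∀ s, 0 ≤ R s := by
    intro s
    have : 1 ≤ exp (A * max s 0) := one_le_exp (by positivity)
    simp only [hR]
    nlinarith
  have hRc : Continuous R := by simp only [hR]; fun_prop
  have hcmeas : Measurable c := hcm.measurable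
  set F0 : ℝ → ℝ → ℝ × ℝ → ℝ × ℝ := fun γ s z => (clip (R s) z.2, γ⁻¹ *
    (-g (γ * clip (R s) z.1) + p (s, γ * clip (R s) z.1, γ * clip (R s) z.2))) with hF0
  set F : ℝ → ℝ × ℝ → ℝ × ℝ := fun s z => F0 (c s) s z with hF
  have hFb : ∀ s z, ‖F s z‖ ≤ A * (1 + R s) := by
    intro s z
    have hcs := hc1 s
    have hcs0 : 0 < c s := by linarith
    have hr := hR0 s
    have h1 := clip_abs hr z.1
    have h2 := clip_abs hr z.2
    rw [hF, hF0, Prod.norm_def]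
    refine max_le ?_ ?_
    · simp only [Real.norm_eq_abs]
      nlinarith
    · simp only [Real.norm_eq_abs]
      rw [abs_mul, abs_inv, abs_of_pos hcs0, inv_mul_le_iff₀ hcs0]
      have h3 := hC (c s * clip (R s) z.1)
      have h4 := hM (s, c s * clip (R s) z.1, c s * clip (R s) z.2)
      rw [abs_mul, abs_of_pos hcs0] at h3
      have h5 := abs_add_le (-g (c s * clip (R s) z.1))
        (p (s, c s * clip (R s) z.1, c s * clip (R s) z.2))
      rw [abs_neg] at h5
      have h6 : c s * |clip (R s) z.1| ≤ c s * R s := by gcongr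
      have h7 : C + M + R s ≤ A * (1 + R s) := by nlinarith [mul_nonneg hC0 hr, mul_nonneg hM0 hr]
      have h8 : c s * (C + M + R s) ≤ c s * (A * (1 + R s)) := by gcongr
      nlinarith
  have hBm : Monotone fun s => A * (1 + R s) := by
    intro s t hst
    have := hRm hst
    show A * (1 + R s) ≤ A * (1 + R t)
    gcongr
  have hmeas : ∀ w : ℝ → ℝ × ℝ, Continuous w → StronglyMeasurable fun s => F s (w s) := by
    intro w hw
    have e1 : Measurable fun s => clip (R s) (w s).1 := by
      have : Continuous fun s => clip (R s) (w s).1 := by unfold clip; fun_prop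
      exact this.measurable
    have e2 : Measurable fun s => clip (R s) (w s).2 := by
      have : Continuous fun s => clip (R s) (w s).2 := by unfold clip; fun_prop
      exact this.measurable
    refine Measurable.stronglyMeasurable ?_
    simp only [hF, hF0]
    refine e2.prodMk (hcmeas.inv.mul ?_)
    refine (hg.measurable.comp (hcmeas.mul e1)).neg.add (hp.measurable.comp ?_)
    exact measurable_id.prodMk ((hcmeas.mul e1).prodMk (hcmeas.mul e2))
  obtain ⟨w, hwc, hw⟩ := carath F (fun s => A * (1 + R s)) hBm (x₀, y₀) hmeas
    (by intro s; simp only [hF, hF0]; unfold clip; fun_prop) hFb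
  have hwR : ∀ t, 0 ≤ t → ‖w t‖ ≤ R t := by
    intro t ht
    rw [hw t, max_eq_left ht]
    refine (norm_add_le _ _).trans ?_
    have h1 : ‖∫ s in (0:ℝ)..t, F s (w s)‖ ≤ ∫ s in (0:ℝ)..t, A * (1 + R s) :=
      intervalIntegral.norm_integral_le_of_norm_le ht
        (Eventually.of_forall fun s _ => hFb s _) hBm.intervalIntegrable
    have h2 : ∫ s in (0:ℝ)..t, A * (1 + R s) = (1 + L) * exp (A * t) - (1 + L) * exp (A * 0) := by
      have h3 : ∫ s in (0:ℝ)..t, A * (1 + R s) = ∫ s in (0:ℝ)..t, (1 + L) * (exp (A * s) * A) := by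
        apply intervalIntegral.integral_congr
        intro s hs
        rw [uIcc_of_le ht] at hs
        simp only [hR, max_eq_left hs.1]
        ring
      rw [h3]
      apply intervalIntegral.integral_eq_sub_of_hasDerivAt
      · intro s _
        have := (((hasDerivAt_id s).const_mul A).exp).const_mul (1 + L)
        simpa using this
      · apply Continuous.intervalIntegrable
        fun_prop
    rw [h2] at h1
    simp only [hR, max_eq_left ht]
    rw [mul_zero, exp_zero] at h1
    linarith
  refine ⟨w, hwc, by rw [hw 0]; simp, fun t ht hct => ?_⟩
  have hcont : ContinuousAt (fun s => F s (w s)) t := by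
    have h1 : Continuous fun s => F0 (c t) s (w s) := by
      simp only [hF0]; unfold clip; fun_prop
    refine h1.continuousAt.congr ?_
    filter_upwards [hct] with s hs
    simp only [hF, hs]
  have hd := intervalIntegral.integral_hasDerivAt_right
    (aux_ii _ _ hBm (hmeas w hwc) (fun s => hFb s _) 0 t)
    ((hmeas w hwc).stronglyMeasurableAtFilter) hcont
  have hval : F t (w t) = ((w t).2, (c t)⁻¹ * (-g (c t * (w t).1)
          + p (t, c t * (w t).1, c t * (w t).2))) := by
    have h1 := hwR t ht
    rw [Prod.norm_def, max_le_iff] at h1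
    simp only [hF, hF0]
    rw [clip_eq h1.1, clip_eq h1.2]
  rw [← hval]
  refine (hd.const_add (x₀, y₀)).hasDerivWithinAt.congr ?_ ?_
  · intro s hs
    rw [hw s, max_eq_left hs]
  · rw [hw t, max_eq_left ht]

lemma imp_finite (k : ℕ) (hk : 1 ≤ k) (tj : ℤ → ℝ)
    (htj0 : 0 ≤ tj 1) (htjk : tj k < 2 * π)
    (htjmono : ∀ i j : ℤ, 1 ≤ i → i < j → j ≤ (k : ℤ) → tj i < tj j)
    (htjper : ∀ j : ℤ, tj (j + k) = tj j + 2 * π) (T : ℝ) :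
    ((range tj ∩ Ioi 0) ∩ Iio T).Finite := by
  have hper : ∀ (m : ℤ) (j : ℤ), tj (j + k * m) = tj j + 2 * π * m := by
    intro m
    induction m using Int.induction_on with
    | zero => intro j; simp
    | succ i ih =>
      intro j
      rw [show j + (k:ℤ) * (i + 1) = (j + k * i) + k by ring, htjper, ih]
      push_cast; ring
    | pred i ih =>
      intro j
      have := htjper (j + k * (-i - 1))
      rw [show j + (k:ℤ) * (-i - 1) + k = (j + k * (-i)) by ring, ih] at this
      push_cast at this ⊢
      linarith
  have hpi := Real.pi_pos
  have hfin : ((Icc (1:ℤ) k) ×ˢ (Icc (-1:ℤ) ⌈T / (2 * π)⌉)).Finite :=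
    (finite_Icc _ _).prod (finite_Icc _ _)
  refine (hfin.image fun q => tj (q.1 + k * q.2)).subset ?_
  rintro _ ⟨⟨⟨j, rfl⟩, h0⟩, hT⟩
  simp only [mem_Ioi, mem_Iio] at h0 hT
  have hk' : (0:ℤ) < k := by exact_mod_cast hk
  set i := (j - 1) % (k:ℤ) + 1 with hi
  set m := (j - 1) / (k:ℤ) with hm
  have hj : i + k * m = j := by
    have := Int.emod_add_mul_ediv (j - 1) k
    rw [hi, hm]; linarith
  have hi1 : 1 ≤ i := by have := Int.emod_nonneg (j - 1) hk'.ne'; omega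
  have hi2 : i ≤ k := by have := Int.emod_lt_of_pos (j - 1) hk'; omega
  refine ⟨(i, m), ⟨⟨hi1, hi2⟩, ?_⟩, by simp only [hj]⟩
  have hv := hper m i
  rw [hj] at hv
  have hlo : 0 ≤ tj i := by
    rcases hi1.eq_or_lt with h | h
    · rw [← h]; exact htj0
    · exact htj0.trans (htjmono 1 i le_rfl h hi2).le
  have hhi : tj i < 2 * π := by
    rcases hi2.eq_or_lt with h | h
    · rw [h]; exact htjk
    · exact (htjmono i k hi1 h le_rfl).trans htjk
  constructor
  · have : (-1:ℝ) < m := by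
      by_contra hcon
      push Not at hcon
      nlinarith
    have : (-1:ℤ) < m := by exact_mod_cast this
    exact this.le
  · have h1 : (m:ℝ) ≤ T / (2 * π) := by
      rw [le_div_iff₀ (by positivity)]
      nlinarith
    have := h1.trans (Int.le_ceil _)
    exact_mod_cast this

/-- The jump factor. -/
noncomputable def jf (D : Set ℝ) (a t : ℝ) : ℝ := (1 + a) ^ (D ∩ Iio t).ncard

lemma jf_left (D : Set ℝ) (hD : ∀ T, (D ∩ Iio T).Finite) (a t : ℝ) :
    ∀ᶠ s in 𝓝[≤] t, jf D a s = jf D a t := by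
  have h : ((D ∩ Iio t)ᶜ : Set ℝ) ∈ 𝓝 t :=
    (hD t).isClosed.isOpen_compl.mem_nhds (fun h => lt_irrefl t (mem_Iio.1 h.2))
  obtain ⟨l, hl, hs⟩ := exists_Ioc_subset_of_mem_nhds h ⟨t - 1, by linarith⟩
  filter_upwards [self_mem_nhdsWithin, mem_nhdsWithin_of_mem_nhds (Ioi_mem_nhds hl)] with s hst hls
  have hst : s ≤ t := hst
  have hls : l < s := hls
  have : D ∩ Iio s = D ∩ Iio t := by
    ext x
    constructor
    · rintro ⟨h1, h2⟩
      exact ⟨h1, lt_of_lt_of_le h2 hst⟩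
    · rintro ⟨h1, h2⟩
      refine ⟨h1, ?_⟩
      by_contra h3
      have h3 : s ≤ x := not_lt.1 h3
      have h2' : x < t := h2
      exact hs ⟨hls.trans_le h3, h2'.le⟩ ⟨h1, h2⟩
  rw [jf, jf, this]

lemma jf_right (D : Set ℝ) (hD : ∀ T, (D ∩ Iio T).Finite) (a t : ℝ) :
    ∀ᶠ s in 𝓝[>] t, jf D a s = (1 + a) ^ (D ∩ Iic t).ncard := by
  have hf : ((D ∩ Iio (t+1)) \ {t}).Finite := (hD _).subset sdiff_subset
  have h : ((((D ∩ Iio (t+1)) \ {t}))ᶜ : Set ℝ) ∈ 𝓝 t :=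
    hf.isClosed.isOpen_compl.mem_nhds (fun h => h.2 rfl)
  obtain ⟨u, hu, hs⟩ := exists_Ico_subset_of_mem_nhds h ⟨t + 1, by linarith⟩
  have hu' : t < min u (t+1) := lt_min hu (by linarith)
  filter_upwards [self_mem_nhdsWithin, mem_nhdsWithin_of_mem_nhds (Iio_mem_nhds hu')] with s hst hls
  have hst : t < s := hst
  have hls : s < min u (t+1) := hls
  have hsu := hls.trans_le (min_le_left _ _)
  have hst1 := hls.trans_le (min_le_right _ _)
  have : D ∩ Iio s = D ∩ Iic t := by
    ext x
    constructor
    · rintro ⟨h1, h2⟩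
      have h2 : x < s := h2
      refine ⟨h1, ?_⟩
      by_contra h3
      have h3 : t < x := not_le.1 h3
      exact hs ⟨h3.le, h2.trans hsu⟩ ⟨⟨h1, h2.trans hst1⟩, h3.ne'⟩
    · rintro ⟨h1, h2⟩
      exact ⟨h1, lt_of_le_of_lt h2 hst⟩
  rw [jf, this]

lemma jf_at (D : Set ℝ) (hD : ∀ T, (D ∩ Iio T).Finite) (a t : ℝ) (ht : t ∉ D) :
    ∀ᶠ s in 𝓝 t, jf D a s = jf D a t := by
  rw [← nhdsLE_sup_nhdsGT, eventually_sup]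
  refine ⟨jf_left D hD a t, ?_⟩
  have : D ∩ Iic t = D ∩ Iio t := by
    ext x
    constructor
    · rintro ⟨h1, h2⟩
      exact ⟨h1, mem_Iio.2 (lt_of_le_of_ne (mem_Iic.1 h2) (fun h => ht (h ▸ h1)))⟩
    · rintro ⟨h1, h2⟩
      exact ⟨h1, mem_Iic.2 (le_of_lt (mem_Iio.1 h2))⟩
  have h := jf_right D hD a t
  rwa [this] at h

lemma jf_jump (D : Set ℝ) (hD : ∀ T, (D ∩ Iio T).Finite) (a t : ℝ) (ht : t ∈ D) :
    ∀ᶠ s in 𝓝[>] t, jf D a s = (1 + a) * jf D a t := by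
  have : D ∩ Iic t = insert t (D ∩ Iio t) := by
    ext x
    simp only [mem_inter_iff, mem_Iic, mem_insert_iff, mem_Iio]
    constructor
    · rintro ⟨h1, h2⟩
      rcases h2.eq_or_lt with h | h
      · exact Or.inl h
      · exact Or.inr ⟨h1, h⟩
    · rintro (rfl | ⟨h1, h2⟩)
      · exact ⟨ht, le_rfl⟩
      · exact ⟨h1, h2.le⟩
  have h := jf_right D hD a t
  rw [this, ncard_insert_of_notMem (fun h => lt_irrefl t (mem_Iio.1 h.2)) (hD t)] at h
  filter_upwards [h] with s hs
  rw [hs, jf, pow_succ']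

theorem global_existence
    (k : ℕ) (hk : 1 ≤ k) (tj : ℤ → ℝ)
    (htj0 : 0 ≤ tj 1) (htjk : tj k < 2 * π)
    (htjmono : ∀ i j : ℤ, 1 ≤ i → i < j → j ≤ (k : ℤ) → tj i < tj j)
    (htjper : ∀ j : ℤ, tj (j + k) = tj j + 2 * π)
    (a : ℝ) (ha : 0 < a)
    (g : ℝ → ℝ) (hg : LocallyLipschitz g) (hg0 : CondG0 g)
    (p : ℝ × ℝ × ℝ → ℝ) (hp : Continuous p)
    (hpb : ∃ M : ℝ, ∀ z, |p z| ≤ M) :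
    ∀ x₀ y₀ : ℝ, ∃ x y : ℝ → ℝ,
      IsSolution tj a g p (Ici 0) x y ∧ x 0 = x₀ ∧ y 0 = y₀ := by
  intro x₀ y₀
  set D : Set ℝ := range tj ∩ Ioi 0 with hDdef
  have hD : ∀ T, (D ∩ Iio T).Finite := fun T =>
    imp_finite k hk tj htj0 htjk htjmono htjper T
  set c := jf D a with hc
  have hcm : Monotone c := by
    intro s t hst
    simp only [hc, jf]
    refine pow_le_pow_right₀ (by linarith) (ncard_le_ncard ?_ (hD t))
    exact inter_subset_inter_right _ (Iio_subset_Iio hst)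
  have hc1 : ∀ t, 1 ≤ c t := fun t => one_le_pow₀ (by linarith)
  have hc0 : c 0 = 1 := by
    have : D ∩ Iio 0 = ∅ := by
      ext x
      simp only [hDdef, mem_inter_iff, mem_Ioi, mem_Iio, mem_empty_iff_false, iff_false]
      rintro ⟨⟨_, h1⟩, h2⟩
      linarith
    simp [hc, jf, this]
  obtain ⟨w, hwc, hw0, hw⟩ := transformed g hg.continuous hg0 p hp hpb c hcm hc1 x₀ y₀
  have hw1 : Continuous fun s => (w s).1 := by fun_prop
  have hw2 : Continuous fun s => (w s).2 := by fun_prop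
  refine ⟨fun t => c t * (w t).1, fun t => c t * (w t).2, ⟨?_, ?_, ?_⟩, ?_, ?_⟩
  · intro t ht
    have hl := jf_left D hD a t
    have key : ∀ f : ℝ → ℝ, Continuous f →
        ContinuousWithinAt (fun t => c t * f t) (Ici 0 ∩ Iic t) t := by
      intro f hf
      refine ContinuousWithinAt.mono ?_ inter_subset_right
      refine (continuous_const.mul hf : Continuous fun s => c t * f s).continuousWithinAt.congr_of_eventuallyEq
        ?_ rfl
      filter_upwards [hl] with s hs
      rw [hc, hs]; rfl
    exact ⟨key _ hw1, key _ hw2⟩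
  · intro t ht hj
    have htD : t ∉ D := by
      rintro ⟨⟨j, hj'⟩, _⟩
      exact hj j hj'.symm
    have hl := jf_at D hD a t htD
    have hd := hw t ht hl
    have hct : c t ≠ 0 := by linarith [hc1 t]
    have d1 : HasDerivWithinAt (fun t => c t * (w t).1) (c t * (w t).2) (Ici 0) t := by
      have h1 : HasDerivWithinAt (fun s => (w s).1) (w t).2 (Ici 0) t :=
        (hasFDerivAt_fst (𝕜 := ℝ) (E := ℝ) (F := ℝ) (p := w t)).comp_hasDerivWithinAt t hd
      refine (h1.const_mul (c t)).congr_of_eventuallyEq ?_ rfl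
      filter_upwards [mem_nhdsWithin_of_mem_nhds hl] with s hs
      have hs : c s = c t := hs
      rw [hs]
    have d2 : HasDerivWithinAt (fun t => c t * (w t).2) (-g (c t * (w t).1)
          + p (t, c t * (w t).1, c t * (w t).2)) (Ici 0) t := by
      have h1 : HasDerivWithinAt (fun s => (w s).2) ((c t)⁻¹ * (-g (c t * (w t).1)
          + p (t, c t * (w t).1, c t * (w t).2))) (Ici 0) t :=
        (hasFDerivAt_snd (𝕜 := ℝ) (E := ℝ) (F := ℝ) (p := w t)).comp_hasDerivWithinAt t hd
      have h2 := h1.const_mul (c t)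
      rw [mul_inv_cancel_left₀ hct] at h2
      refine h2.congr_of_eventuallyEq ?_ rfl
      filter_upwards [mem_nhdsWithin_of_mem_nhds hl] with s hs
      have hs : c s = c t := hs
      rw [hs]
    exact ⟨d1.continuousWithinAt, d2.continuousWithinAt, d1, d2⟩
  · intro j hj
    rw [interior_Ici] at hj
    have hl := jf_jump D hD a (tj j) ⟨⟨j, rfl⟩, hj⟩
    have key : ∀ f : ℝ → ℝ, Continuous f →
        Tendsto (fun t => c t * f t) (𝓝[>] (tj j)) (𝓝 ((1 + a) * (c (tj j) * f (tj j)))) := by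
      intro f hf
      have h1 : Continuous fun s => (1 + a) * (c (tj j) * f s) := by fun_prop
      refine ((h1.tendsto (tj j)).mono_left nhdsWithin_le_nhds).congr' ?_
      filter_upwards [hl] with s hs
      have hs : c s = (1 + a) * c (tj j) := hs
      rw [hs]; ring
    exact ⟨key _ hw1, key _ hw2⟩
  · simp [hc0, hw0]
  · simp [hc0, hw0]
end

section
/- Let g : ℝ → ℝ be continuous with G(x) = ∫₀ˣ g(s) ds, let m ∈ ℝ, and let q : [s₁, s₂] → ℝ be continuous with q(t) ≥ m for all t. Suppose x, y : [s₁, s₂] → ℝ are continuously differentiable with x'(t) = y(t) and y'(t) = −g(x(t)) + q(t) for all t ∈ [s₁, s₂], y(t) > 0 for t ∈ [s₁, s₂), and y(s₂) = 0. Then for every t ∈ [s₁, s₂], (1/2)·y(t)² ≤ G(x(s₂)) − G(x(t)) − m·(x(s₂) − x(t)). -/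
open Real Set

theorem energy_estimate
    (g : ℝ → ℝ) (hg : Continuous g) (m : ℝ)
    (s₁ s₂ : ℝ) (hs : s₁ < s₂)
    (q : ℝ → ℝ) (hq : ContinuousOn q (Icc s₁ s₂))
    (hqm : ∀ t ∈ Icc s₁ s₂, m ≤ q t)
    (x y : ℝ → ℝ)
    (hx : ∀ t ∈ Icc s₁ s₂, HasDerivAt x (y t) t)
    (hy : ∀ t ∈ Icc s₁ s₂, HasDerivAt y (-g (x t) + q t) t)
    (hypos : ∀ t ∈ Ico s₁ s₂, 0 < y t) (hy2 : y s₂ = 0) :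
    ∀ t ∈ Icc s₁ s₂,
      (1 / 2) * (y t) ^ 2 ≤
        (∫ s in (0:ℝ)..(x s₂), g s) - (∫ s in (0:ℝ)..(x t), g s) - m * (x s₂ - x t) := by
  have hG : ∀ a : ℝ, HasDerivAt (fun u => ∫ s in (0:ℝ)..u, g s) (g a) a := fun a =>
    intervalIntegral.integral_hasDerivAt_right (hg.intervalIntegrable _ _)
      (hg.stronglyMeasurableAtFilter _ _) hg.continuousAt
  have hH : ∀ t ∈ Icc s₁ s₂, HasDerivAt
      (fun t => (1 / 2) * (y t) ^ 2 + (∫ s in (0:ℝ)..(x t), g s) - m * x t)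
      (y t * (q t - m)) t := by
    intro t ht
    have h1 := ((hy t ht).pow 2).const_mul (1 / 2 : ℝ)
    have h2 := (hG (x t)).comp t (hx t ht)
    have h3 := (hx t ht).const_mul m
    refine ((h1.add h2).sub h3).congr_deriv ?_
    push_cast
    ring
  have hmono : MonotoneOn
      (fun t => (1 / 2) * (y t) ^ 2 + (∫ s in (0:ℝ)..(x t), g s) - m * x t) (Icc s₁ s₂) := by
    apply monotoneOn_of_deriv_nonneg (convex_Icc _ _)
    · exact fun t ht => (hH t ht).continuousAt.continuousWithinAt
    · exact fun t ht => (hH t (interior_subset ht)).differentiableAt.differentiableWithinAt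
    · intro t ht
      rw [(hH t (interior_subset ht)).deriv]
      rw [interior_Icc] at ht
      exact mul_nonneg (hypos t ⟨ht.1.le, ht.2⟩).le
        (sub_nonneg.2 (hqm t ⟨ht.1.le, ht.2.le⟩))
  intro t ht
  have h := hmono ht (right_mem_Icc.2 hs.le) ht.2
  simp only [hy2] at h
  linarith
end

section
/- Let g : ℝ → ℝ be continuous with G(x) = ∫₀ˣ g(s) ds, let m ∈ ℝ, and let q : [s₁, s₂] → ℝ be continuous with q(t) ≥ m for all t. Suppose x, y : [s₁, s₂] → ℝ are continuously differentiable with x'(t) = y(t) and y'(t) = −g(x(t)) + q(t) for all t ∈ [s₁, s₂], y(t) > 0 for t ∈ [s₁, s₂), and y(s₂) = 0. Write x₁ = x(s₁) and x₂ = x(s₂). Then s₂ − s₁ ≥ ∫_{x₁}^{x₂} dξ / √(2·(G(x₂) − G(ξ) − m·(x₂ − ξ))). -/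
open Real Set

theorem time_estimate
    (g : ℝ → ℝ) (hg : Continuous g) (m : ℝ)
    (s₁ s₂ : ℝ) (hs : s₁ < s₂)
    (q : ℝ → ℝ) (hq : ContinuousOn q (Icc s₁ s₂))
    (hqm : ∀ t ∈ Icc s₁ s₂, m ≤ q t)
    (x y : ℝ → ℝ)
    (hx : ∀ t ∈ Icc s₁ s₂, HasDerivAt x (y t) t)
    (hy : ∀ t ∈ Icc s₁ s₂, HasDerivAt y (-g (x t) + q t) t)
    (hypos : ∀ t ∈ Ico s₁ s₂, 0 < y t) (hy2 : y s₂ = 0) :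
    (∫ ξ in (x s₁)..(x s₂),
        1 / Real.sqrt (2 * ((∫ s in (0:ℝ)..(x s₂), g s) - (∫ s in (0:ℝ)..ξ, g s)
          - m * (x s₂ - ξ))))
      ≤ s₂ - s₁ := by
  have hxc : ContinuousOn x (Icc s₁ s₂) := fun t ht => (hx t ht).continuousAt.continuousWithinAt
  have hint : interior (Icc s₁ s₂) = Ioo s₁ s₂ := interior_Icc
  have hmono : StrictMonoOn x (Icc s₁ s₂) := by
    apply strictMonoOn_of_deriv_pos (convex_Icc _ _) hxc
    intro t ht
    rw [hint] at ht
    rw [(hx t (Ioo_subset_Icc_self ht)).deriv]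
    exact hypos t (Ioo_subset_Ico_self ht)
  have hl : s₁ ∈ Icc s₁ s₂ := left_mem_Icc.2 hs.le
  have hr : s₂ ∈ Icc s₁ s₂ := right_mem_Icc.2 hs.le
  have hx12 : x s₁ ≤ x s₂ := hmono.monotoneOn hl hr hs.le
  have himg : x '' Icc s₁ s₂ = Icc (x s₁) (x s₂) := by
    apply Subset.antisymm
    · rintro _ ⟨t, ht, rfl⟩
      exact ⟨hmono.monotoneOn hl ht ht.1, hmono.monotoneOn ht hr ht.2⟩
    · exact intermediate_value_Icc hs.le hxc
  have hE : ∀ t ∈ Icc s₁ s₂, HasDerivAt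
      (fun t => y t ^ 2 / 2 + (∫ s in (0:ℝ)..(x t), g s) - m * x t) (y t * (q t - m)) t := by
    intro t ht
    have h1 : HasDerivAt (fun u => ∫ s in (0:ℝ)..u, g s) (g (x t)) (x t) :=
      intervalIntegral.integral_hasDerivAt_right (hg.intervalIntegrable _ _)
        (hg.stronglyMeasurableAtFilter _ _) hg.continuousAt
    have h2 := h1.comp t (hx t ht)
    have h3 := ((((hy t ht).pow 2).div_const 2).add h2).sub ((hx t ht).const_mul m)
    refine HasDerivAt.congr_deriv (f := _) h3 ?_
    simp
    ring
  have hEm : MonotoneOn (fun t => y t ^ 2 / 2 + (∫ s in (0:ℝ)..(x t), g s) - m * x t)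
      (Icc s₁ s₂) := by
    apply monotoneOn_of_deriv_nonneg (convex_Icc _ _)
      (fun t ht => (hE t ht).continuousAt.continuousWithinAt)
    · intro t ht
      exact (hE t (interior_subset ht)).differentiableAt.differentiableWithinAt
    · intro t ht
      rw [hint] at ht
      rw [(hE t (Ioo_subset_Icc_self ht)).deriv]
      exact mul_nonneg (hypos t (Ioo_subset_Ico_self ht)).le
        (sub_nonneg.2 (hqm t (Ioo_subset_Icc_self ht)))
  rw [intervalIntegral.integral_of_le hx12, ← MeasureTheory.integral_Icc_eq_integral_Ioc, ← himg,
    MeasureTheory.integral_image_eq_integral_abs_deriv_smul measurableSet_Icc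
      (fun t ht => (hx t ht).hasDerivWithinAt) hmono.injOn]
  have hone : ∫ _t in Icc s₁ s₂, (1:ℝ) = s₂ - s₁ := by
    simp [hs.le]
  rw [← hone]
  apply MeasureTheory.integral_mono_of_nonneg
  · exact Filter.Eventually.of_forall fun t => by
      simp only [Pi.zero_apply, smul_eq_mul]
      positivity
  · exact continuousOn_const.integrableOn_Icc
  · refine (MeasureTheory.ae_restrict_iff' measurableSet_Icc).2 (Filter.Eventually.of_forall ?_)
    intro t ht
    have h := hEm ht hr ht.2
    simp only [hy2] at h
    have hy0 : 0 ≤ y t := by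
      rcases eq_or_lt_of_le ht.2 with e | e
      · rw [e, hy2]
      · exact (hypos t ⟨ht.1, e⟩).le
    simp only [smul_eq_mul, mul_one_div]
    rw [abs_of_nonneg hy0]
    apply div_le_one_of_le₀ _ (Real.sqrt_nonneg _)
    apply Real.le_sqrt_of_sq_le
    linarith
end

section
/- Let δ > 0, let s₁ < s₂ be real numbers, and let φ : [s₁, s₂] → ℝ be continuous and differentiable at all but finitely many points of [s₁, s₂], with φ'(t) ≥ −(δ²·cos²φ(t) + sin²φ(t)) at every point of differentiability. If φ(s₁) = π/4 and φ(s₂) = −π/4, then s₂ − s₁ ≥ (2/δ)·arctan(1/δ). -/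
open Real Set

lemma apt_mono (f : ℝ → ℝ) (T : Finset ℝ) : ∀ a b : ℝ, a ≤ b → ContinuousOn f (Icc a b) →
    (∀ t ∈ Ioo a b, t ∉ T → DifferentiableAt ℝ f t ∧ 0 ≤ deriv f t) → f a ≤ f b := by
  induction T using Finset.induction_on with
  | empty =>
    intro a b hab hc hd
    refine monotoneOn_of_deriv_nonneg (convex_Icc a b) hc ?_ ?_ (left_mem_Icc.2 hab)
      (right_mem_Icc.2 hab) hab
    · rw [interior_Icc]
      exact fun t ht => (hd t ht (by simp)).1.differentiableWithinAt
    · rw [interior_Icc]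
      exact fun t ht => (hd t ht (by simp)).2
  | insert x T hx ih =>
    intro a b hab hc hd
    by_cases hxm : x ∈ Ioo a b
    · have h1 : f a ≤ f x := by
        refine ih a x hxm.1.le (hc.mono (Icc_subset_Icc_right hxm.2.le)) ?_
        intro t ht htT
        exact hd t ⟨ht.1, ht.2.trans hxm.2⟩ (by simp [htT, ht.2.ne])
      have h2 : f x ≤ f b := by
        refine ih x b hxm.2.le (hc.mono (Icc_subset_Icc_left hxm.1.le)) ?_
        intro t ht htT
        exact hd t ⟨hxm.1.trans ht.1, ht.2⟩ (by simp [htT, ht.1.ne'])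
      exact h1.trans h2
    · refine ih a b hab hc ?_
      intro t ht htT
      refine hd t ht ?_
      have : t ≠ x := by rintro rfl; exact hxm ht
      simp [htT, this]

theorem angular_passage_time
    (δ : ℝ) (hδ : 0 < δ) (s₁ s₂ : ℝ) (hs : s₁ < s₂)
    (φ : ℝ → ℝ) (hφc : ContinuousOn φ (Icc s₁ s₂))
    (T : Finset ℝ)
    (hφd : ∀ t ∈ Icc s₁ s₂, t ∉ T →
      DifferentiableAt ℝ φ t ∧
        -(δ ^ 2 * Real.cos (φ t) ^ 2 + Real.sin (φ t) ^ 2) ≤ deriv φ t)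
    (h₁ : φ s₁ = π / 4) (h₂ : φ s₂ = -(π / 4)) :
    (2 / δ) * Real.arctan (1 / δ) ≤ s₂ - s₁ := by
  have hpos : ∀ x : ℝ, 0 < δ ^ 2 * Real.cos x ^ 2 + Real.sin x ^ 2 := by
    intro x
    by_cases h : Real.cos x = 0
    · have := Real.sin_sq_add_cos_sq x
      rw [h] at this ⊢
      nlinarith
    · positivity
  set g : ℝ → ℝ := fun x => (δ ^ 2 * Real.cos x ^ 2 + Real.sin x ^ 2)⁻¹ with hg
  have hgc : Continuous g := by
    refine Continuous.inv₀ (by fun_prop) (fun x => (hpos x).ne')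
  set G : ℝ → ℝ := fun x => ∫ y in (-(π/4))..x, g y with hG
  have hGd : ∀ x, HasDerivAt G (g x) x := fun x =>
    intervalIntegral.integral_hasDerivAt_right (hgc.intervalIntegrable _ _)
      hgc.stronglyMeasurable.stronglyMeasurableAtFilter hgc.continuousAt
  have hG0 : G (-(π/4)) = 0 := by simp [hG]
  have hG1 : G (π/4) = (2 / δ) * Real.arctan (1 / δ) := by
    have hpi := Real.pi_pos
    have : G (π/4) = (fun x => Real.arctan (Real.tan x / δ) / δ) (π/4)
        - (fun x => Real.arctan (Real.tan x / δ) / δ) (-(π/4)) := by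
      refine intervalIntegral.integral_eq_sub_of_hasDerivAt (f := fun x => Real.arctan (Real.tan x / δ) / δ) (f' := g) (a := -(π/4)) (b := π/4) ?_ (hgc.intervalIntegrable _ _)
      intro x hx
      rw [uIcc_of_le (by linarith)] at hx
      have hc : 0 < Real.cos x :=
        Real.cos_pos_of_mem_Ioo ⟨by linarith [hx.1], by linarith [hx.2]⟩
      have h := (((Real.hasDerivAt_tan hc.ne').div_const δ).arctan).div_const δ
      refine HasDerivAt.congr_deriv h ?_
      symm
      have := (hpos x).ne'
      simp only [hg]
      rw [Real.tan_eq_sin_div_cos]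
      have h3 : 1 + (Real.sin x / Real.cos x / δ) ^ 2 =
        (δ ^ 2 * Real.cos x ^ 2 + Real.sin x ^ 2) / (δ ^ 2 * Real.cos x ^ 2) := by
        field_simp
      rw [h3]
      field_simp
    rw [this]
    simp only [Real.tan_neg, Real.tan_pi_div_four, neg_div, Real.arctan_neg]
    ring
  have key := apt_mono (fun t => G (φ t) + t) T s₁ s₂ hs.le ?_ ?_
  · simp only [h₁, h₂, hG0, hG1] at key
    linarith
  · have hGc : Continuous G := continuous_iff_continuousAt.2 fun x => (hGd x).continuousAt
    exact (hGc.comp_continuousOn hφc).add continuousOn_id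
  · intro t ht htT
    obtain ⟨hd, hle⟩ := hφd t ⟨ht.1.le, ht.2.le⟩ htT
    have h : HasDerivAt (fun t => G (φ t) + t) (g (φ t) * deriv φ t + 1) t :=
      ((hGd (φ t)).comp t hd.hasDerivAt).add (hasDerivAt_id t)
    refine ⟨h.differentiableAt, ?_⟩
    rw [h.deriv]
    have hp := hpos (φ t)
    have hgp : 0 < g (φ t) := inv_pos.2 hp
    have h1 : g (φ t) * (δ ^ 2 * Real.cos (φ t) ^ 2 + Real.sin (φ t) ^ 2) = 1 :=
      inv_mul_cancel₀ hp.ne'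
    have h2 := mul_le_mul_of_nonneg_left hle hgp.le
    linarith
end

section
/- Suppose g : ℝ → ℝ is continuous with g(x)·sign(x) → +∞ as |x| → +∞, and p : ℝ × ℝ × ℝ → ℝ is bounded. Then there is no solution (x, y) of the impulsive system (S) on [0, +∞) such that x(t) → +∞ as t → +∞ and y is bounded on [0, +∞). -/
open Real Set Filter MeasureTheory

theorem no_unbounded_x_bounded_y_solution
    (k : ℕ) (hk : 1 ≤ k) (tj : ℤ → ℝ)
    (htj0 : 0 ≤ tj 1) (htjk : tj k < 2 * π)
    (htjmono : ∀ i j : ℤ, 1 ≤ i → i < j → j ≤ (k : ℤ) → tj i < tj j)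
    (htjper : ∀ j : ℤ, tj (j + k) = tj j + 2 * π)
    (a : ℝ) (ha : 0 < a)
    (g : ℝ → ℝ) (hg : Continuous g)
    (hg1 : Tendsto (fun x => g x * Real.sign x) (cocompact ℝ) atTop)
    (p : ℝ × ℝ × ℝ → ℝ) (hpb : ∃ M : ℝ, ∀ z, |p z| ≤ M) :
    ¬ ∃ x y : ℝ → ℝ, IsSolution tj a g p (Ici 0) x y ∧
        Tendsto x atTop atTop ∧ ∃ M : ℝ, ∀ t ∈ Ici (0:ℝ), |y t| ≤ M := by
  rintro ⟨x, y, ⟨-, hsol, -⟩, hx, M, hM⟩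
  obtain ⟨P, hP⟩ := hpb
  have hper : ∀ (q r : ℤ), tj (r + q * k) = tj r + 2 * π * q := by
    intro q r
    induction q using Int.induction_on with
    | zero => simp
    | succ i ih =>
      have h := htjper (r + i * k)
      rw [ih] at h
      have e : r + ((i : ℤ) + 1) * k = r + i * k + k := by ring
      rw [e, h]; push_cast; ring
    | pred i ih =>
      have h := htjper (r + (-(i : ℤ) - 1) * k)
      have e : r + (-(i : ℤ) - 1) * k + k = r + -(i : ℤ) * k := by ring
      rw [e, ih] at h
      push_cast at h ⊢; linarith
  have hpi := Real.pi_pos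
  have hk' : (1 : ℤ) ≤ k := by exact_mod_cast hk
  have hlo : ∀ r : ℤ, 1 ≤ r → r ≤ k → 0 ≤ tj r := by
    intro r h1 h2
    rcases h1.eq_or_lt with h | h
    · rw [← h]; exact htj0
    · exact htj0.trans (htjmono 1 r le_rfl h h2).le
  have hhi : ∀ r : ℤ, 1 ≤ r → r ≤ k → tj r ≤ tj k := by
    intro r h1 h2
    rcases h2.eq_or_lt with h | h
    · rw [h]
    · exact (htjmono r k h1 h le_rfl).le
  have hfree : ∀ (n : ℕ) (t : ℝ), tj k + 2 * π * n < t → t < 2 * π + 2 * π * n →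
      ∀ j : ℤ, t ≠ tj j := by
    intro n t h1 h2 j hj
    have e : j = ((j - 1) % k + 1) + ((j - 1) / k) * k := by
      have := Int.emod_add_mul_ediv (j - 1) k
      linarith
    have r0 := Int.emod_nonneg (j - 1) (show (k : ℤ) ≠ 0 by omega)
    have r1 := Int.emod_lt_of_pos (j - 1) (show (0 : ℤ) < k by omega)
    rw [e, hper] at hj
    have a1 := hlo ((j - 1) % k + 1) (by omega) (by omega)
    have a2 := hhi ((j - 1) % k + 1) (by omega) (by omega)
    generalize (j - 1) / (k : ℤ) = q at *
    rcases le_or_gt q n with h | h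
    · have : (q : ℝ) ≤ n := by exact_mod_cast h
      nlinarith
    · have : (n : ℝ) + 1 ≤ q := by exact_mod_cast h
      nlinarith
  have hk0 := hlo k hk' le_rfl
  obtain ⟨c, hc, hc2⟩ := exists_between htjk
  obtain ⟨d, hcd, hd⟩ := exists_between hc2
  have hgt : Tendsto g atTop atTop := by
    have h := hg1.mono_left (atTop_le_cocompact)
    refine h.congr' ?_
    filter_upwards [eventually_gt_atTop 0] with z hz
    rw [Real.sign_of_pos hz, mul_one]
  have hev := (hgt.comp hx).eventually_gt_atTop (P + 2 * M / (d - c))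
  obtain ⟨T, hT⟩ := eventually_atTop.1 hev
  obtain ⟨n, hn⟩ := exists_nat_ge T
  have hn0 : (0 : ℝ) ≤ n := n.cast_nonneg
  have hnn : (n : ℝ) ≤ 2 * π * n := by nlinarith [Real.pi_gt_three]
  have hD : ∀ t ∈ Icc (c + 2 * π * n) (d + 2 * π * n), 0 < t ∧
      HasDerivAt y (-g (x t) + p (t, x t, y t)) t := by
    intro t ht
    have t0 : 0 < t := by linarith [ht.1]
    exact ⟨t0, (hsol t t0.le (hfree n t (by linarith [ht.1]) (by linarith [ht.2]))).2.2.2.hasDerivAt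
      (Ici_mem_nhds t0)⟩
  obtain ⟨ξ, hξ, he⟩ := exists_hasDerivAt_eq_slope y (fun t => -g (x t) + p (t, x t, y t))
    (show c + 2 * π * n < d + 2 * π * n by linarith)
    (fun t ht => (hD t ht).2.continuousAt.continuousWithinAt)
    (fun t ht => (hD t (Ioo_subset_Icc_self ht)).2)
  have b1 := abs_le.1 (hM (d + 2 * π * n) (by simp only [mem_Ici]; linarith))
  have b2 := abs_le.1 (hM (c + 2 * π * n) (by simp only [mem_Ici]; linarith))
  have b3 := (abs_le.1 (hP (ξ, x ξ, y ξ))).2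
  have b4 := hT ξ (by linarith [hξ.1])
  simp only [Function.comp] at b4
  have e2 : d + 2 * π * n - (c + 2 * π * n) = d - c := by ring
  rw [e2] at he
  have hdc : 0 < d - c := by linarith
  have b5 : -(2 * M / (d - c)) ≤ (y (d + 2 * π * n) - y (c + 2 * π * n)) / (d - c) := by
    rw [← neg_div]
    exact div_le_div_of_nonneg_right (by linarith [b1.1, b2.2]) hdc.le
  linarith
end

section
/- Suppose g : ℝ → ℝ is continuous with g(x)·sign(x) → +∞ as |x| → +∞, and p : ℝ × ℝ × ℝ → ℝ is bounded. Then there exists c > 0 such that for all t ∈ ℝ and all (x, y) ∈ ℝ² with x² + y² ≥ c², one has x·(−g(x) + p(t, x, y)) − y² < 0. (Equivalently, the angular component of the planar vector field (y, −g(x) + p(t, x, y)) is strictly decreasing outside the disk of radius c.) -/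
open Real Filter

theorem angular_component_negative_outside_disk
    (g : ℝ → ℝ) (hg : Continuous g)
    (hg1 : Tendsto (fun x => g x * Real.sign x) (cocompact ℝ) atTop)
    (p : ℝ × ℝ × ℝ → ℝ) (hpb : ∃ M : ℝ, ∀ z, |p z| ≤ M) :
    ∃ c : ℝ, 0 < c ∧ ∀ t x y : ℝ, c ^ 2 ≤ x ^ 2 + y ^ 2 →
      x * (-g x + p (t, x, y)) - y ^ 2 < 0 := by
  obtain ⟨M, hM⟩ := hpb
  have hM0 : 0 ≤ M := (abs_nonneg _).trans (hM (0, 0, 0))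
  have h1 := hg1.eventually_ge_atTop (M + 1)
  rw [← Metric.cobounded_eq_cocompact] at h1
  obtain ⟨R0, -, hR0⟩ := (Metric.hasBasis_cobounded_compl_closedBall (0 : ℝ)).eventually_iff.1 h1
  obtain ⟨R, hRpos, hR⟩ : ∃ R : ℝ, 0 < R ∧ ∀ x, R < |x| → M + 1 ≤ g x * Real.sign x := by
    refine ⟨max R0 1, by positivity, fun x hx => hR0 ?_⟩
    simpa using (le_max_left R0 1).trans_lt hx
  obtain ⟨K, hK⟩ := (isCompact_Icc (a := -R) (b := R)).exists_bound_of_continuousOn hg.continuousOn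
  have hK0 : 0 ≤ K := (norm_nonneg _).trans (hK 0 ⟨by linarith, hRpos.le⟩)
  have hS : 0 ≤ R * (K + M) := by positivity
  refine ⟨R + R * (K + M) + 1, by positivity, fun t x y hc => ?_⟩
  have hp := abs_le.1 (hM (t, x, y))
  rcases le_or_gt |x| R with hx | hx
  · have hg' : |g x| ≤ K := hK x (abs_le.1 hx)
    have hb : |x * (-g x + p (t, x, y))| ≤ R * (K + M) := by
      rw [abs_mul]
      refine mul_le_mul hx ((abs_add_le _ _).trans ?_) (abs_nonneg _) hRpos.le
      rw [abs_neg]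
      exact add_le_add hg' (hM _)
    have hb' := (abs_le.1 hb).2
    have hx2 : x ^ 2 ≤ R ^ 2 := sq_le_sq' (abs_le.1 hx).1 (abs_le.1 hx).2
    generalize R * (K + M) = S at *
    nlinarith [mul_nonneg hRpos.le hS, sq_nonneg S]
  · have h := hR x hx
    have hx0 : x ≠ 0 := by
      rintro rfl
      simp at hx
      linarith
    rcases lt_or_gt_of_ne hx0 with h0 | h0
    · rw [Real.sign_of_neg h0] at h
      nlinarith [sq_nonneg y]
    · rw [Real.sign_of_pos h0] at h
      nlinarith [sq_nonneg y]
end
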